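/- arXiv:math/0703644 — 6 statements merged into one kernel-verified Lean document; each statement's English description precedes it below -/
import Mathlib

section
/- Assume W is an injective cogenerator for X. Let 0 → N' → N → N'' → 0 be an exact sequence in A such that N' lies in cores~(X), N'' lies in cores~(W), N' ⊥ W and N'' ⊥ W. Then N lies in cores~(W), i.e. N admits a proper W-coresolution. -/
open CategoryTheory CategoryTheory.Limits CategoryTheory.Abelian

universe w v u

variable {C : Type u} [Category.{v} C] [Abelian C]

/-- A class of objects is closed under isomorphisms. -/
def IsoClosed (𝒲 : Set C) : Prop :=
  ∀ ⦃A B : C⦄, (A ≅ B) → A ∈ 𝒲 → B ∈ 𝒲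

/-- A class of objects is closed under finite direct sums (part of being an
additive subcategory). -/
def SumClosed (𝒲 : Set C) : Prop :=
  ∀ ⦃A B : C⦄, A ∈ 𝒲 → B ∈ 𝒲 → (A ⊞ B) ∈ 𝒲

/-- A class of objects is closed under extensions. -/
def ExtensionClosed (𝒲 : Set C) : Prop :=
  ∀ ⦃A₁ A₂ A₃ : C⦄ (f : A₁ ⟶ A₂) (g : A₂ ⟶ A₃) (w : f ≫ g = 0),
    (ShortComplex.mk f g w).ShortExact → A₁ ∈ 𝒲 → A₃ ∈ 𝒲 → A₂ ∈ 𝒲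

/-- A class of objects is closed under kernels of epimorphisms. -/
def KerEpiClosed (𝒲 : Set C) : Prop :=
  ∀ ⦃A₁ A₂ A₃ : C⦄ (f : A₁ ⟶ A₂) (g : A₂ ⟶ A₃) (w : f ≫ g = 0),
    (ShortComplex.mk f g w).ShortExact → A₂ ∈ 𝒲 → A₃ ∈ 𝒲 → A₁ ∈ 𝒲

/-- A class of objects is closed under cokernels of monomorphisms. -/
def CokerMonoClosed (𝒲 : Set C) : Prop :=
  ∀ ⦃A₁ A₂ A₃ : C⦄ (f : A₁ ⟶ A₂) (g : A₂ ⟶ A₃) (w : f ≫ g = 0),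
    (ShortComplex.mk f g w).ShortExact → A₁ ∈ 𝒲 → A₂ ∈ 𝒲 → A₃ ∈ 𝒲

section ExtDefs

variable [HasExt.{w} C]

/-- `X ⊥ Y`, i.e. `Ext^i(X, Y) = 0` for all `i ≥ 1`. -/
def extPerp (X Y : C) : Prop :=
  ∀ i : ℕ, 1 ≤ i → Subsingleton (Abelian.Ext X Y i)

end ExtDefs

/-- `𝒲` is a cogenerator for `𝒳`: `𝒲 ⊆ 𝒳` and every object of `𝒳` embeds in an
object of `𝒲` with cokernel in `𝒳`. -/
def IsCogen (𝒲 𝒳 : Set C) : Prop :=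
  𝒲 ⊆ 𝒳 ∧ ∀ X ∈ 𝒳, ∃ (W X' : C) (i : X ⟶ W) (p : W ⟶ X') (w : i ≫ p = 0),
    W ∈ 𝒲 ∧ X' ∈ 𝒳 ∧ (ShortComplex.mk i p w).ShortExact

/-- `𝒱` is a generator for `𝒴`: `𝒱 ⊆ 𝒴` and every object of `𝒴` is a quotient of an
object of `𝒱` with kernel in `𝒴`. -/
def IsGen (𝒱 𝒴 : Set C) : Prop :=
  𝒱 ⊆ 𝒴 ∧ ∀ Y ∈ 𝒴, ∃ (Y' V : C) (i : Y' ⟶ V) (p : V ⟶ Y) (w : i ≫ p = 0),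
    V ∈ 𝒱 ∧ Y' ∈ 𝒴 ∧ (ShortComplex.mk i p w).ShortExact

section ExtDefs2

variable [HasExt.{w} C]

/-- `𝒲` is an injective cogenerator for `𝒳`. -/
def IsInjCogen (𝒲 𝒳 : Set C) : Prop :=
  IsCogen 𝒲 𝒳 ∧ ∀ X ∈ 𝒳, ∀ W ∈ 𝒲, extPerp X W

/-- `𝒱` is a projective generator for `𝒴`. -/
def IsProjGen (𝒱 𝒴 : Set C) : Prop :=
  IsGen 𝒱 𝒴 ∧ ∀ V ∈ 𝒱, ∀ Y ∈ 𝒴, extPerp V Y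

end ExtDefs2

/-- The data `(P, d, ε)` is a resolution of `M`: the augmented complex
`⋯ → P₁ → P₀ → M → 0` is exact. -/
structure IsResolution (P : ℕ → C) (d : ∀ n, P (n + 1) ⟶ P n) (M : C) (ε : P 0 ⟶ M) :
    Prop where
  w0 : d 0 ≫ ε = 0
  w : ∀ n, d (n + 1) ≫ d n = 0
  epi : Epi ε
  exact0 : (ShortComplex.mk (d 0) ε w0).Exact
  exact : ∀ n, (ShortComplex.mk (d (n + 1)) (d n) (w n)).Exact

/-- The data `(Q, δ, η)` is a coresolution of `M`: the augmented complex
`0 → M → Q⁰ → Q¹ → ⋯` is exact. -/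
structure IsCoresolution (Q : ℕ → C) (δ : ∀ n, Q n ⟶ Q (n + 1)) (M : C) (η : M ⟶ Q 0) :
    Prop where
  w0 : η ≫ δ 0 = 0
  w : ∀ n, δ n ≫ δ (n + 1) = 0
  mono : Mono η
  exact0 : (ShortComplex.mk η (δ 0) w0).Exact
  exact : ∀ n, (ShortComplex.mk (δ n) (δ (n + 1)) (w n)).Exact

/-- `Hom(W', -)` applied to the augmented complex `⋯ → P₁ → P₀ → M → 0` is exact for
every `W'` in `𝒳` (properness of the resolution). -/
def ResHomExact (𝒳 : Set C) (P : ℕ → C) (d : ∀ n, P (n + 1) ⟶ P n) {M : C}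
    (ε : P 0 ⟶ M) : Prop :=
  ∀ W ∈ 𝒳,
    (∀ φ : W ⟶ M, ∃ ψ : W ⟶ P 0, ψ ≫ ε = φ) ∧
    (∀ φ : W ⟶ P 0, φ ≫ ε = 0 → ∃ ψ : W ⟶ P 1, ψ ≫ d 0 = φ) ∧
    (∀ (n : ℕ) (φ : W ⟶ P (n + 1)), φ ≫ d n = 0 → ∃ ψ : W ⟶ P (n + 2), ψ ≫ d (n + 1) = φ)

/-- `Hom(-, W')` applied to the augmented complex `0 → M → Q⁰ → Q¹ → ⋯` is exact for
every `W'` in `𝒲` (properness of the coresolution). -/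
def CoresHomExact (𝒲 : Set C) (Q : ℕ → C) (δ : ∀ n, Q n ⟶ Q (n + 1)) {M : C}
    (η : M ⟶ Q 0) : Prop :=
  ∀ W ∈ 𝒲,
    (∀ φ : M ⟶ W, ∃ ψ : Q 0 ⟶ W, η ≫ ψ = φ) ∧
    (∀ φ : Q 0 ⟶ W, η ≫ φ = 0 → ∃ ψ : Q 1 ⟶ W, δ 0 ≫ ψ = φ) ∧
    (∀ (n : ℕ) (φ : Q (n + 1) ⟶ W), δ n ≫ φ = 0 → ∃ ψ : Q (n + 2) ⟶ W, δ (n + 1) ≫ ψ = φ)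

/-- `M` admits a proper `𝒳`-resolution, i.e. `M ∈ res~(𝒳)`. -/
def MemProperRes (𝒳 : Set C) (M : C) : Prop :=
  ∃ (P : ℕ → C) (d : ∀ n, P (n + 1) ⟶ P n) (ε : P 0 ⟶ M),
    (∀ n, P n ∈ 𝒳) ∧ IsResolution P d M ε ∧ ResHomExact 𝒳 P d ε

/-- `M` admits a proper `𝒲`-coresolution, i.e. `M ∈ cores~(𝒲)`. -/
def MemProperCores (𝒲 : Set C) (M : C) : Prop :=
  ∃ (Q : ℕ → C) (δ : ∀ n, Q n ⟶ Q (n + 1)) (η : M ⟶ Q 0),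
    (∀ n, Q n ∈ 𝒲) ∧ IsCoresolution Q δ M η ∧ CoresHomExact 𝒲 Q δ η

/-- `M` has finite `𝒴`-projective dimension: it admits a resolution
`0 → Y_n → ⋯ → Y_0 → M → 0` with all `Y_i` in `𝒴`, i.e. `M ∈ res^f(𝒴)`. -/
def FinResDim (𝒴 : Set C) (M : C) : Prop :=
  ∃ (n : ℕ) (P : ℕ → C) (d : ∀ k, P (k + 1) ⟶ P k) (ε : P 0 ⟶ M),
    (∀ k ≤ n, P k ∈ 𝒴) ∧ (∀ k, n < k → IsZero (P k)) ∧ IsResolution P d M ε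

/-- `M` has finite `𝒳`-injective dimension: it admits a coresolution
`0 → M → X^0 → ⋯ → X^n → 0` with all `X^i` in `𝒳`, i.e. `M ∈ cores^f(𝒳)`. -/
def FinCoresDim (𝒳 : Set C) (M : C) : Prop :=
  ∃ (n : ℕ) (Q : ℕ → C) (δ : ∀ k, Q k ⟶ Q (k + 1)) (η : M ⟶ Q 0),
    (∀ k ≤ n, Q k ∈ 𝒳) ∧ (∀ k, n < k → IsZero (Q k)) ∧ IsCoresolution Q δ M η

/-- The `ℤ`-indexed complex `(X, d)` is totally `𝒳`-acyclic: all terms lie in `𝒳`,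
it is exact, and `Hom(W, -)` and `Hom(-, W)` applied to it are exact for all `W ∈ 𝒳`. -/
structure IsTotallyAcyclic (𝒳 : Set C) (X : ℤ → C) (d : ∀ n : ℤ, X (n + 1) ⟶ X n) :
    Prop where
  mem : ∀ n, X n ∈ 𝒳
  w : ∀ n, d (n + 1) ≫ d n = 0
  exact : ∀ n, (ShortComplex.mk (d (n + 1)) (d n) (w n)).Exact
  homExact : ∀ W ∈ 𝒳, ∀ (n : ℤ) (φ : W ⟶ X (n + 1)), φ ≫ d n = 0 →
    ∃ ψ : W ⟶ X (n + 1 + 1), ψ ≫ d (n + 1) = φ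
  homExact' : ∀ W ∈ 𝒳, ∀ (n : ℤ) (φ : X (n + 1) ⟶ W), d (n + 1) ≫ φ = 0 →
    ∃ ψ : X n ⟶ W, d n ≫ ψ = φ

/-- The Gorenstein subcategory `G(𝒳)`: objects isomorphic to `Coker(∂₁)` of a totally
`𝒳`-acyclic complex. -/
def GorClass (𝒳 : Set C) : Set C :=
  {M | ∃ (X : ℤ → C) (d : ∀ n : ℤ, X (n + 1) ⟶ X n),
    IsTotallyAcyclic 𝒳 X d ∧ Nonempty (cokernel (d 0) ≅ M)}

/-- Iterated Gorenstein subcategories: `G^0(𝒳) = 𝒳`, `G^{n+1}(𝒳) = G(G^n(𝒳))`. -/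
def GorIter (𝒳 : Set C) : ℕ → Set C
  | 0 => 𝒳
  | n + 1 => GorClass (GorIter 𝒳 n)

/-- The upper triangular matrix morphism `[[a, b], [0, c]]` between biproducts. -/
noncomputable def triMat {P' P'' Q' Q'' : C} (a : P' ⟶ Q') (b : P'' ⟶ Q') (c : P'' ⟶ Q'') :
    P' ⊞ P'' ⟶ Q' ⊞ Q'' :=
  biprod.lift (biprod.fst ≫ a + biprod.snd ≫ b) (biprod.snd ≫ c)


section Helpers

theorem aux_cok_se {A B : C} (i : A ⟶ B) [Mono i] :
    (ShortComplex.mk i (cokernel.π i) (cokernel.condition i)).ShortExact :=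
  ShortComplex.ShortExact.mk' (ShortComplex.exact_cokernel i) inferInstance
    (by dsimp; infer_instance)

theorem aux_snake {S₁ S₂ : ShortComplex C} (h₁ : S₁.ShortExact) (h₂ : S₂.ShortExact)
    (φ : S₁ ⟶ S₂) [Mono φ.τ₃] :
    ∃ w, (ShortComplex.mk (cokernel.map φ.τ₁ φ.τ₂ S₁.f S₂.f φ.comm₁₂.symm.symm)
      (cokernel.map φ.τ₂ φ.τ₃ S₁.g S₂.g φ.comm₂₃) w).ShortExact := by
  have w : cokernel.map φ.τ₁ φ.τ₂ S₁.f S₂.f φ.comm₁₂ ≫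
      cokernel.map φ.τ₂ φ.τ₃ S₁.g S₂.g φ.comm₂₃ = 0 := by
    rw [← cancel_epi (cokernel.π _)]; simp
  have w0 : kernel.map φ.τ₁ φ.τ₂ S₁.f S₂.f φ.comm₁₂ ≫
      kernel.map φ.τ₂ φ.τ₃ S₁.g S₂.g φ.comm₂₃ = 0 := by
    rw [← cancel_mono (kernel.ι _)]; simp
  have e1 := h₁.epi_g
  have e2 := h₂.epi_g
  have e3 := h₂.mono_f
  let I : ShortComplex.SnakeInput C :=
    { L₀ := ShortComplex.mk _ _ w0
      L₁ := S₁
      L₂ := S₂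
      L₃ := ShortComplex.mk _ _ w
      v₀₁ := { τ₁ := kernel.ι _, τ₂ := kernel.ι _, τ₃ := kernel.ι _ }
      v₁₂ := φ
      v₂₃ := { τ₁ := cokernel.π _, τ₂ := cokernel.π _, τ₃ := cokernel.π _ }
      h₀ := by
        apply ShortComplex.isLimitOfIsLimitπ <;>
          apply (KernelFork.isLimitMapConeEquiv _ _).2 <;> exact kernelIsKernel _
      h₃ := by
        apply ShortComplex.isColimitOfIsColimitπ <;>
          apply (CokernelCofork.isColimitMapCoconeEquiv _ _).2 <;> exact cokernelIsCokernel _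
      L₁_exact := h₁.exact
      L₂_exact := h₂.exact
      epi_L₁_g := e1
      mono_L₂_f := e3 }
  refine ⟨w, ShortComplex.ShortExact.mk' I.L₃_exact ?_ ?_⟩
  · exact I.L₂'_exact.mono_g ((isZero_kernel_of_mono φ.τ₃).eq_of_src _ _)
  · have : Epi I.L₂.g := e2
    exact I.epi_L₃_g

theorem aux_comp {X Y Z : C} (f : X ⟶ Y) (g : Y ⟶ Z) [Mono g] :
    ∃ w, (ShortComplex.mk (cokernel.map f (f ≫ g) (𝟙 _) g (by simp))
      (cokernel.map (f ≫ g) g f (𝟙 _) (by simp)) w).ShortExact := by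
  let I := kernelCokernelCompSequence.snakeInput f g
  refine ⟨I.L₃.zero, ShortComplex.ShortExact.mk' I.L₃_exact ?_ ?_⟩
  · exact I.L₂'_exact.mono_g ((isZero_kernel_of_mono g).eq_of_src _ _)
  · have : Epi I.L₂.g := by change Epi biprod.snd; infer_instance
    exact I.epi_L₃_g

/-- precompose with an epi, postcompose with a mono -/
theorem aux_exact {A A' B D D' : C} (q : A' ⟶ A) [Epi q] (a : A ⟶ B) (b : B ⟶ D)
    (j : D ⟶ D') [Mono j] (w : a ≫ b = 0) (w' : (q ≫ a) ≫ (b ≫ j) = 0)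
    (h : (ShortComplex.mk a b w).Exact) : (ShortComplex.mk (q ≫ a) (b ≫ j) w').Exact := by
  have h1 : (q ≫ a) ≫ b = 0 := by simp [w]
  have h2 : (ShortComplex.mk (q ≫ a) b h1).Exact := by
    let φ : ShortComplex.mk (q ≫ a) b h1 ⟶ ShortComplex.mk a b w :=
      { τ₁ := q, τ₂ := 𝟙 _, τ₃ := 𝟙 _ }
    have : Epi φ.τ₁ := by dsimp [φ]; infer_instance
    have : IsIso φ.τ₂ := by dsimp [φ]; infer_instance
    have : Mono φ.τ₃ := by dsimp [φ]; infer_instance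
    exact (ShortComplex.exact_iff_of_epi_of_isIso_of_mono φ).2 h
  let φ : ShortComplex.mk (q ≫ a) b h1 ⟶ ShortComplex.mk (q ≫ a) (b ≫ j) w' :=
    { τ₁ := 𝟙 _, τ₂ := 𝟙 _, τ₃ := j }
  have : Epi φ.τ₁ := by dsimp [φ]; infer_instance
  have : IsIso φ.τ₂ := by dsimp [φ]; infer_instance
  have : Mono φ.τ₃ := by dsimp [φ]; infer_instance
  exact (ShortComplex.exact_iff_of_epi_of_isIso_of_mono φ).1 h2

section HE

variable [HasExt.{w} C]

theorem aux_extend {S : ShortComplex C} (hS : S.ShortExact) {W : C}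
    (h : Subsingleton (Abelian.Ext.{w} S.X₃ W 1)) (φ : S.X₁ ⟶ W) :
    ∃ ψ : S.X₂ ⟶ W, S.f ≫ ψ = φ := by
  obtain ⟨x, hx⟩ := Ext.contravariant_sequence_exact₁ hS W (Ext.mk₀ φ) (add_zero 1)
    (h.elim _ _)
  obtain ⟨ψ, rfl⟩ := (Ext.mk₀_bijective _ _).2 x
  refine ⟨ψ, (Ext.mk₀_bijective _ _).1 ?_⟩
  rw [← hx, Ext.mk₀_comp_mk₀]

theorem aux_ext_mid {S : ShortComplex C} (hS : S.ShortExact) {W : C}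
    (h1 : Subsingleton (Abelian.Ext.{w} S.X₁ W 1)) (h3 : Subsingleton (Abelian.Ext.{w} S.X₃ W 1)) :
    Subsingleton (Abelian.Ext.{w} S.X₂ W 1) := by
  refine subsingleton_of_forall_eq 0 fun x => ?_
  obtain ⟨y, rfl⟩ := Ext.contravariant_sequence_exact₂ hS W x (h1.elim _ _)
  rw [h3.elim y 0, Ext.comp_zero]

theorem aux_ext_quot {S : ShortComplex C} (hS : S.ShortExact) {W : C}
    (h2 : Subsingleton (Abelian.Ext.{w} S.X₂ W 1))
    (hl : ∀ φ : S.X₁ ⟶ W, ∃ ψ : S.X₂ ⟶ W, S.f ≫ ψ = φ) :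
    Subsingleton (Abelian.Ext.{w} S.X₃ W 1) := by
  refine subsingleton_of_forall_eq 0 fun x => ?_
  obtain ⟨y, rfl⟩ := Ext.contravariant_sequence_exact₃ hS W x (h2.elim _ _) (add_zero 1)
  obtain ⟨φ, rfl⟩ := (Ext.mk₀_bijective _ _).2 y
  obtain ⟨ψ, rfl⟩ := hl φ
  rw [← Ext.mk₀_comp_mk₀, hS.extClass_comp_assoc]

/-- `𝒳`-coresolutions that are `Hom(-, 𝒲)`-exact. -/
def AuxCores (𝒲 𝒳 : Set C) (M : C) : Prop :=
  ∃ (Q : ℕ → C) (δ : ∀ n, Q n ⟶ Q (n + 1)) (η : M ⟶ Q 0),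
    (∀ n, Q n ∈ 𝒳) ∧ IsCoresolution Q δ M η ∧ CoresHomExact 𝒲 Q δ η

theorem aux_shift (𝒲 𝒳 : Set C) {M : C} (h : AuxCores 𝒲 𝒳 M) :
    ∃ (X : C) (η : M ⟶ X), X ∈ 𝒳 ∧ Mono η ∧ AuxCores 𝒲 𝒳 (cokernel η) ∧
      ∀ W ∈ 𝒲, ∀ φ : M ⟶ W, ∃ ψ : X ⟶ W, η ≫ ψ = φ := by
  obtain ⟨Q, δ, η, hQ, hr, hp⟩ := h
  refine ⟨Q 0, η, hQ 0, hr.mono, ⟨fun n => Q (n + 1), fun n => δ (n + 1),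
    cokernel.desc η (δ 0) hr.w0, fun n => hQ _, ?_, ?_⟩, fun W hW => (hp W hW).1⟩
  · refine ⟨?_, fun n => hr.w _, ?_, ?_, fun n => hr.exact _⟩
    · rw [← cancel_epi (cokernel.π η)]; simp [hr.w]
    · exact hr.exact0.mono_cokernelDesc
    · let φ : ShortComplex.mk (δ 0) (δ 1) (hr.w 0) ⟶ ShortComplex.mk
          (cokernel.desc η (δ 0) hr.w0) (δ 1)
          (by rw [← cancel_epi (cokernel.π η)]; simp [hr.w]) :=
        { τ₁ := cokernel.π η, τ₂ := 𝟙 _, τ₃ := 𝟙 _ }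
      have : Epi φ.τ₁ := by dsimp [φ]; infer_instance
      have : IsIso φ.τ₂ := by dsimp [φ]; infer_instance
      have : Mono φ.τ₃ := by dsimp [φ]; infer_instance
      exact (ShortComplex.exact_iff_of_epi_of_isIso_of_mono φ).1 (hr.exact 0)
  · intro W hW
    obtain ⟨p1, p2, p3⟩ := hp W hW
    refine ⟨fun φ => ?_, fun φ hφ => p3 0 φ ?_, fun n φ hφ => p3 (n + 1) φ hφ⟩
    · obtain ⟨ψ, hψ⟩ := p2 (cokernel.π η ≫ φ) (by simp)
      refine ⟨ψ, ?_⟩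
      rw [← cancel_epi (cokernel.π η)]
      simp [hψ]
    · rw [← cokernel.π_desc η (δ 0) hr.w0, Category.assoc, hφ, comp_zero]

/-- Extension closure of the basic classes. -/
inductive AuxS (𝒲 𝒳 : Set C) : C → Prop
  | ofX (N : C) (h : N ∈ 𝒳) : AuxS 𝒲 𝒳 N
  | cores (N : C) (h : AuxCores 𝒲 𝒳 N)
      (hp : ∀ W ∈ 𝒲, Subsingleton (Abelian.Ext.{w} N W 1)) : AuxS 𝒲 𝒳 N
  | ext (S : ShortComplex C) (hS : S.ShortExact) (h1 : AuxS 𝒲 𝒳 S.X₁) (h3 : AuxS 𝒲 𝒳 S.X₃) :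
      AuxS 𝒲 𝒳 S.X₂

theorem AuxS.perp {𝒲 𝒳 : Set C} (hcog : IsInjCogen.{w} 𝒲 𝒳) {N : C} (h : AuxS.{w} 𝒲 𝒳 N) :
    ∀ W ∈ 𝒲, Subsingleton (Abelian.Ext.{w} N W 1) := by
  induction h with
  | ofX N h => exact fun W hW => hcog.2 N h W hW 1 le_rfl
  | cores N h hp => exact hp
  | ext S hS h1 h3 i1 i3 => exact fun W hW => aux_ext_mid hS (i1 W hW) (i3 W hW)

theorem aux_cogen {𝒲 𝒳 : Set C} (h𝒳iso : IsoClosed 𝒳) (hcog : IsInjCogen.{w} 𝒲 𝒳) {X : C}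
    (hX : X ∈ 𝒳) : ∃ (W : C) (i : X ⟶ W), W ∈ 𝒲 ∧ Mono i ∧ cokernel i ∈ 𝒳 := by
  obtain ⟨W, X', i, p, w0, hW, hX', hS⟩ := hcog.1.2 X hX
  have := hS.epi_g
  refine ⟨W, i, hW, hS.mono_f, h𝒳iso ?_ hX'⟩
  exact IsColimit.coconePointUniqueUpToIso hS.gIsCokernel (colimit.isColimit (parallelPair i 0))

theorem AuxS.step {𝒲 𝒳 : Set C} (h𝒲sum : SumClosed 𝒲) (h𝒳iso : IsoClosed 𝒳)
    (hcog : IsInjCogen.{w} 𝒲 𝒳) {N : C} (h : AuxS.{w} 𝒲 𝒳 N) :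
    ∃ (W : C) (i : N ⟶ W), W ∈ 𝒲 ∧ Mono i ∧ AuxS.{w} 𝒲 𝒳 (cokernel i) := by
  induction h with
  | ofX N h =>
    obtain ⟨W, i, hW, hi, hc⟩ := aux_cogen h𝒳iso hcog h
    exact ⟨W, i, hW, hi, .ofX _ hc⟩
  | cores N h hp =>
    obtain ⟨X, η, hX, hη, hK, hl⟩ := aux_shift 𝒲 𝒳 h
    obtain ⟨W, i, hW, hi, hc⟩ := aux_cogen h𝒳iso hcog hX
    refine ⟨W, η ≫ i, hW, inferInstance, ?_⟩
    obtain ⟨w0, hS⟩ := aux_comp η i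
    refine AuxS.ext _ hS (.cores _ hK fun W' hW' => ?_) (.ofX _ hc)
    exact aux_ext_quot (aux_cok_se η) (hcog.2 X hX W' hW' 1 le_rfl) (hl W' hW')
  | ext S hS h1 h3 ih1 ih3 =>
    obtain ⟨W₁, i₁, hW₁, hi₁, hc₁⟩ := ih1
    obtain ⟨W₃, i₃, hW₃, hi₃, hc₃⟩ := ih3
    obtain ⟨e, he⟩ := aux_extend hS (h3.perp hcog W₁ hW₁) i₁
    let T : ShortComplex C := ShortComplex.mk (biprod.inl : W₁ ⟶ W₁ ⊞ W₃) biprod.snd (by simp)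
    have hT : T.ShortExact := (ShortComplex.Splitting.ofHasBinaryBiproduct W₁ W₃).shortExact
    let φ : S ⟶ T :=
      { τ₁ := i₁
        τ₂ := biprod.lift e (S.g ≫ i₃)
        τ₃ := i₃
        comm₁₂ := by dsimp [T]; ext <;> simp [he]
        comm₂₃ := by dsimp [T]; simp }
    have : Mono φ.τ₁ := hi₁
    have : Mono φ.τ₃ := hi₃
    have := hS.mono_f
    have := hT.mono_f
    obtain ⟨w0, hL⟩ := aux_snake hS hT φ
    exact ⟨W₁ ⊞ W₃, φ.τ₂, h𝒲sum hW₁ hW₃, ShortComplex.mono_τ₂_of_exact_of_mono φ hS.exact,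
      AuxS.ext _ hL hc₁ hc₃⟩

theorem aux_build {𝒲 : Set C} (P : C → Prop)
    (hperp : ∀ N, P N → ∀ W ∈ 𝒲, Subsingleton (Abelian.Ext.{w} N W 1))
    (hstep : ∀ N, P N → ∃ (W : C) (i : N ⟶ W), W ∈ 𝒲 ∧ Mono i ∧ P (cokernel i))
    {N : C} (hN : P N) : MemProperCores 𝒲 N := by
  choose W i hW hi hc using hstep
  let a : ℕ → {N : C // P N} := fun n =>
    Nat.rec ⟨N, hN⟩ (fun _ b => ⟨cokernel (i b.1 b.2), hc b.1 b.2⟩) n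
  let Q : ℕ → C := fun n => W (a n).1 (a n).2
  let ι : ∀ n, (a n).1 ⟶ Q n := fun n => i (a n).1 (a n).2
  let p : ∀ n, Q n ⟶ (a (n + 1)).1 := fun n => cokernel.π (ι n)
  have hι : ∀ n, Mono (ι n) := fun n => hi _ _
  have hpe : ∀ n, Epi (p n) := fun n => inferInstanceAs (Epi (cokernel.π (ι n)))
  have hz : ∀ n, ι n ≫ p n = 0 := fun n => cokernel.condition (ι n)
  have hse : ∀ n, (ShortComplex.mk (ι n) (p n) (hz n)).ShortExact := fun n => aux_cok_se (ι n)
  have hext : ∀ n, ∀ V ∈ 𝒲, ∀ φ : (a n).1 ⟶ V, ∃ ψ : Q n ⟶ V, ι n ≫ ψ = φ :=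
    fun n V hV φ => aux_extend (hse n) (hperp _ (a (n + 1)).2 V hV) φ
  have hfac : ∀ n, ∀ V ∈ 𝒲, ∀ φ : Q n ⟶ V, ι n ≫ φ = 0 →
      ∃ ψ : Q (n + 1) ⟶ V, (p n ≫ ι (n + 1)) ≫ ψ = φ := by
    intro n V hV φ h
    have := hpe n
    obtain ⟨ψ, hψ⟩ := hext (n + 1) V hV ((hse n).exact.desc φ h)
    refine ⟨ψ, ?_⟩
    rw [Category.assoc, hψ]
    exact (hse n).exact.g_desc φ h
  clear_value p ι
  refine ⟨Q, fun n => p n ≫ ι (n + 1), ι 0, fun n => hW _ _, ⟨?_, fun n => ?_, hι 0, ?_, ?_⟩, ?_⟩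
  · rw [← Category.assoc, hz, zero_comp]
  · rw [Category.assoc, ← Category.assoc (ι (n + 1)), hz, zero_comp, comp_zero]
  · have := aux_exact (𝟙 _) (ι 0) (p 0) (ι 1) (hz 0)
      (by rw [Category.id_comp, ← Category.assoc, hz, zero_comp]) (hse 0).exact
    simpa only [Category.id_comp] using this
  · intro n
    exact aux_exact (p n) (ι (n + 1)) (p (n + 1)) (ι (n + 2)) (hz _) _ (hse _).exact
  · intro V hV
    refine ⟨hext 0 V hV, hfac 0 V hV, fun n φ h => hfac (n + 1) V hV φ ?_⟩
    have := hpe n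
    rw [← cancel_epi (p n), ← Category.assoc, h, comp_zero]

end HE

end Helpers

variable [EnoughProjectives C] [EnoughInjectives C] [HasExt.{w} C]

/-- Lemma 2.1(a): assume `𝒲` is an injective cogenerator for `𝒳`. Given a
short exact sequence `0 → N' → N → N'' → 0` with `N' ∈ cores~(𝒳)`, `N'' ∈ cores~(𝒲)`,
`N' ⊥ 𝒲` and `N'' ⊥ 𝒲`, one has `N ∈ cores~(𝒲)`. -/
theorem stmt_5 (𝒲 𝒳 : Set C)
    (h𝒲iso : IsoClosed 𝒲) (h𝒲sum : SumClosed 𝒲)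
    (h𝒳iso : IsoClosed 𝒳) (h𝒳sum : SumClosed 𝒳)
    (hcog : IsInjCogen 𝒲 𝒳)
    {N' N N'' : C} (f : N' ⟶ N) (g : N ⟶ N'') (w' : f ≫ g = 0)
    (hse : (ShortComplex.mk f g w').ShortExact)
    (hN' : MemProperCores 𝒳 N') (hN'' : MemProperCores 𝒲 N'')
    (hN'perp : ∀ W ∈ 𝒲, extPerp N' W) (hN''perp : ∀ W ∈ 𝒲, extPerp N'' W) :
    MemProperCores 𝒲 N := by
  refine aux_build (AuxS.{w} 𝒲 𝒳) (fun _ h => h.perp hcog)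
    (fun _ h => h.step h𝒲sum h𝒳iso hcog) (AuxS.ext _ hse (.cores _ ?_ ?_) (.cores _ ?_ ?_))
  · obtain ⟨Q, δ, η, h1, h2, h3⟩ := hN'
    exact ⟨Q, δ, η, h1, h2, fun W hW => h3 W (hcog.1.1 hW)⟩
  · exact fun W hW => hN'perp W hW 1 le_rfl
  · obtain ⟨Q, δ, η, h1, h2, h3⟩ := hN''
    exact ⟨Q, δ, η, fun n => hcog.1.1 (h1 n), h2, h3⟩
  · exact fun W hW => hN''perp W hW 1 le_rfl
end

section
/- (a) If W is an injective cogenerator for X, M lies in cores~(X) and M ⊥ W, then M lies in cores~(W). (b) Dually, if V is a projective generator for Y, N lies in res~(Y) and V ⊥ N, then N lies in res~(V). -/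
open CategoryTheory CategoryTheory.Limits CategoryTheory.Abelian

universe w v u

variable {C : Type u} [Category.{v} C] [Abelian C]

namespace Aux

/-- Elementary short exact sequences. -/
structure SE {D : Type u} [Category.{v} D] [Abelian D] {A B E : D} (i : A ⟶ B) (p : B ⟶ E) :
    Prop where
  w : i ≫ p = 0
  mono : Mono i
  epi : Epi p
  ker : ∀ ⦃T : D⦄ (k : T ⟶ B), k ≫ p = 0 → ∃ l : T ⟶ A, l ≫ i = k
  coker : ∀ ⦃T : D⦄ (k : B ⟶ T), i ≫ k = 0 → ∃ l : E ⟶ T, p ≫ l = k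

section

variable {D : Type u} [Category.{v} D] [Abelian D]

lemma SE.of {A B E : D} {i : A ⟶ B} {p : B ⟶ E} {w : i ≫ p = 0}
    (h : (ShortComplex.mk i p w).ShortExact) : SE i p := by
  have hm : Mono i := h.mono_f
  have he : Epi p := h.epi_g
  have hm' : Mono (ShortComplex.mk i p w).f := hm
  have he' : Epi (ShortComplex.mk i p w).g := he
  exact ⟨w, hm, he, fun T k hk => ⟨h.exact.lift k hk, h.exact.lift_f k hk⟩,
    fun T k hk => ⟨h.exact.desc k hk, h.exact.g_desc k hk⟩⟩

lemma SE.to {A B E : D} {i : A ⟶ B} {p : B ⟶ E} (h : SE i p) :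
    (ShortComplex.mk i p h.w).ShortExact := by
  have := h.mono
  have := h.epi
  refine { exact := ?_, mono_f := h.mono, epi_g := h.epi }
  refine ShortComplex.exact_of_f_is_kernel _ (KernelFork.IsLimit.ofι' _ _ fun {T} k hk => ?_)
  exact ⟨(h.ker k hk).choose, (h.ker k hk).choose_spec⟩

lemma SE.mkKer {A B E : D} {i : A ⟶ B} {p : B ⟶ E} (w : i ≫ p = 0) (hm : Mono i) (he : Epi p)
    (h : ∀ ⦃T : D⦄ (k : T ⟶ B), k ≫ p = 0 → ∃ l : T ⟶ A, l ≫ i = k) : SE i p := by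
  refine SE.of (w := w) { exact := ?_, mono_f := hm, epi_g := he }
  refine ShortComplex.exact_of_f_is_kernel _ (KernelFork.IsLimit.ofι' _ _ fun {T} k hk => ?_)
  exact ⟨(h k hk).choose, (h k hk).choose_spec⟩

lemma SE.mkCoker {A B E : D} {i : A ⟶ B} {p : B ⟶ E} (w : i ≫ p = 0) (hm : Mono i) (he : Epi p)
    (h : ∀ ⦃T : D⦄ (k : B ⟶ T), i ≫ k = 0 → ∃ l : E ⟶ T, p ≫ l = k) : SE i p := by
  refine SE.of (w := w) { exact := ?_, mono_f := hm, epi_g := he }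
  refine ShortComplex.exact_of_g_is_cokernel _
    (CokernelCofork.IsColimit.ofπ' _ _ fun {T} k hk => ?_)
  exact ⟨(h k hk).choose, (h k hk).choose_spec⟩

lemma SE.cokernel {A B : D} (i : A ⟶ B) [Mono i] : SE i (cokernel.π i) :=
  SE.mkCoker (cokernel.condition i) inferInstance inferInstance
    fun _ k hk => ⟨cokernel.desc i k hk, cokernel.π_desc i k hk⟩

/-- Elementary form of vanishing of `Ext^1(M, W)`. -/
def LP (M W : D) : Prop :=
  ∀ ⦃A B : D⦄ (i : A ⟶ B) (p : B ⟶ M), SE i p → ∀ f : A ⟶ W, ∃ g : B ⟶ W, i ≫ g = f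

lemma LP.ext {M₁ M M₂ W : D} {j : M₁ ⟶ M} {q : M ⟶ M₂} (h : SE j q) (h₁ : LP M₁ W)
    (h₂ : LP M₂ W) : LP M W := by
  intro A B i p hip f
  have := hip.mono
  have := hip.epi
  have := h.mono
  have := h.epi
  have s₁ : SE (pullback.lift (f := j) (g := p) 0 i (by simp [hip.w])) (pullback.fst j p) := by
    refine SE.mkKer (by simp [pullback.lift_fst, pullback.lift_snd]) ?_ inferInstance fun T k hk => ?_
    · apply mono_of_mono_fac (pullback.lift_snd _ _ _)
    · obtain ⟨l, hl⟩ := hip.ker (k ≫ pullback.snd j p) (by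
        rw [Category.assoc, ← pullback.condition, reassoc_of% hk, zero_comp])
      exact ⟨l, pullback.hom_ext (by simp [hk, pullback.lift_fst]) (by simp [hl, pullback.lift_snd])⟩
  have s₂ : SE (pullback.snd j p) (p ≫ q) := by
    refine SE.mkKer ?_ inferInstance (epi_comp _ _) fun T k hk => ?_
    · rw [← Category.assoc, ← pullback.condition, Category.assoc, h.w, comp_zero]
    · obtain ⟨l, hl⟩ := h.ker (k ≫ p) (by simpa using hk)
      exact ⟨pullback.lift l k hl, pullback.lift_snd _ _ _⟩
  obtain ⟨g, hg⟩ := h₁ _ _ s₁ f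
  obtain ⟨g', hg'⟩ := h₂ _ _ s₂ g
  refine ⟨g', ?_⟩
  rw [← hg, ← hg', pullback.lift_snd_assoc]

lemma LP.quot {M X M₁ W : D} {j : M ⟶ X} {q : X ⟶ M₁} (h : SE j q) (hX : LP X W)
    (hs : ∀ φ : M ⟶ W, ∃ ψ : X ⟶ W, j ≫ ψ = φ) : LP M₁ W := by
  intro A B i p hip f
  have := hip.mono
  have := hip.epi
  have := h.mono
  have := h.epi
  have s₁ : SE (pullback.lift (f := q) (g := p) 0 i (by simp [hip.w])) (pullback.fst q p) := by
    refine SE.mkKer (by simp [pullback.lift_fst, pullback.lift_snd]) ?_ inferInstance fun T k hk => ?_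
    · apply mono_of_mono_fac (pullback.lift_snd _ _ _)
    · obtain ⟨l, hl⟩ := hip.ker (k ≫ pullback.snd q p) (by
        rw [Category.assoc, ← pullback.condition, reassoc_of% hk, zero_comp])
      exact ⟨l, pullback.hom_ext (by simp [hk, pullback.lift_fst]) (by simp [hl, pullback.lift_snd])⟩
  have s₂ : SE (pullback.lift (f := q) (g := p) j 0 (by simp [h.w])) (pullback.snd q p) := by
    refine SE.mkKer (by simp [pullback.lift_fst, pullback.lift_snd]) ?_ inferInstance fun T k hk => ?_
    · apply mono_of_mono_fac (pullback.lift_fst _ _ _)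
    · obtain ⟨l, hl⟩ := h.ker (k ≫ pullback.fst q p) (by
        rw [Category.assoc, pullback.condition, reassoc_of% hk, zero_comp])
      exact ⟨l, pullback.hom_ext (by simp [hl, pullback.lift_fst]) (by simp [hk, pullback.lift_snd])⟩
  obtain ⟨g, hg⟩ := hX _ _ s₁ f
  obtain ⟨ψ, hψ⟩ := hs (pullback.lift (f := q) (g := p) j 0 (by simp [h.w]) ≫ g)
  obtain ⟨l, hl⟩ := s₂.coker (g - pullback.fst q p ≫ ψ) (by
    rw [Preadditive.comp_sub, pullback.lift_fst_assoc, hψ, sub_self])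
  refine ⟨l, ?_⟩
  have e := congrArg (fun t => pullback.lift (f := q) (g := p) 0 i (by simp [hip.w]) ≫ t) hl
  simpa [Preadditive.comp_sub, hg, pullback.lift_fst_assoc, pullback.lift_snd_assoc] using e

lemma third {K X K₁ W X₁ E : D} {j : K ⟶ X} {q : X ⟶ K₁} {a : X ⟶ W} {b : W ⟶ X₁} {c : W ⟶ E}
    (h₁ : SE j q) (h₂ : SE a b) (h₃ : SE (j ≫ a) c) :
    ∃ (x : K₁ ⟶ E) (y : E ⟶ X₁), SE x y := by
  have := h₁.mono
  have := h₁.epi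
  have := h₂.mono
  have := h₂.epi
  have := h₃.epi
  obtain ⟨x, hx⟩ := h₁.coker (a ≫ c) (by rw [← Category.assoc, h₃.w])
  obtain ⟨y, hy⟩ := h₃.coker b (by rw [Category.assoc, h₂.w, comp_zero])
  refine ⟨x, y, SE.mkCoker ?_ ?_ ?_ ?_⟩
  · rw [← cancel_epi q, reassoc_of% hx, hy, h₂.w, comp_zero]
  · refine Preadditive.mono_of_cancel_zero _ fun {T} k hk => ?_
    obtain ⟨l, hl⟩ := h₃.ker (pullback.fst q k ≫ a) (by
      rw [Category.assoc, ← hx, pullback.condition_assoc, hk, comp_zero])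
    have e : l ≫ j = pullback.fst q k := by
      rw [← cancel_mono a, Category.assoc, hl]
    rw [← cancel_epi (pullback.snd q k), ← pullback.condition, ← e, Category.assoc, h₁.w,
      comp_zero, comp_zero]
  · exact epi_of_epi_fac hy
  · intro T k hk
    obtain ⟨l, hl⟩ := h₂.coker (c ≫ k) (by rw [← Category.assoc, ← hx, Category.assoc, hk, comp_zero])
    exact ⟨l, by rw [← cancel_epi c, reassoc_of% hy, hl]⟩

lemma pushSE {K E X W F : D} {x : K ⟶ E} {y : E ⟶ X} {m : K ⟶ W} {c : W ⟶ F} {g : E ⟶ W}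
    (h₁ : SE x y) (h₂ : SE m c) (hg : x ≫ g = m) :
    ∃ (s : E ⟶ W ⊞ X) (t : W ⊞ X ⟶ F), SE s t := by
  have := h₁.epi
  have := h₂.mono
  have := h₂.epi
  obtain ⟨s, hs⟩ := h₁.coker (g ≫ c) (by rw [reassoc_of% hg, h₂.w])
  refine ⟨biprod.lift g y, biprod.desc c (-s), SE.mkCoker ?_ ?_ ?_ ?_⟩
  · simp [biprod.lift_desc, hs]
  · refine Preadditive.mono_of_cancel_zero _ fun {T} k hk => ?_
    have e₁ : k ≫ g = 0 := by simpa using congrArg (· ≫ biprod.fst) hk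
    have e₂ : k ≫ y = 0 := by simpa using congrArg (· ≫ biprod.snd) hk
    obtain ⟨l, hl⟩ := h₁.ker k e₂
    have : l = 0 := by
      rw [← cancel_mono m, ← hg, reassoc_of% hl, e₁, zero_comp]
    rw [← hl, this, zero_comp]
  · exact epi_of_epi_fac (biprod.inl_desc c (-s))
  · intro T k hk
    have e : g ≫ biprod.inl ≫ k + y ≫ biprod.inr ≫ k = 0 := by
      rw [← hk, biprod.lift_eq]
      simp
    obtain ⟨l, hl⟩ := h₂.coker (biprod.inl ≫ k) (by
      have := congrArg (x ≫ ·) e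
      simpa [reassoc_of% hg, reassoc_of% h₁.w] using this)
    refine ⟨l, biprod.hom_ext' _ _ (by simp [hl]) ?_⟩
    rw [← cancel_epi y]
    simp only [biprod.inr_desc_assoc, Preadditive.neg_comp, Preadditive.comp_neg]
    rw [reassoc_of% hs, hl]
    exact neg_eq_of_add_eq_zero_right e

/-- One-step closure: every object of `P` is left orthogonal to `𝒲` and embeds in an object of
`𝒳` with cokernel in `P`. -/
def Step (𝒲 𝒳 : Set D) (P : D → Prop) : Prop :=
  ∀ K, P K → (∀ W ∈ 𝒲, LP K W) ∧
    ∃ (X K' : D) (i : K ⟶ X) (p : X ⟶ K'), X ∈ 𝒳 ∧ SE i p ∧ P K'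

lemma step_improve {𝒲 𝒳 : Set D} (hsub : 𝒲 ⊆ 𝒳) (hsum : SumClosed 𝒳)
    (hcog : ∀ X ∈ 𝒳, ∃ (W X' : D) (i : X ⟶ W) (p : W ⟶ X'), W ∈ 𝒲 ∧ X' ∈ 𝒳 ∧ SE i p)
    (hLP : ∀ X ∈ 𝒳, ∀ W ∈ 𝒲, LP X W) {P : D → Prop} (hP : Step 𝒲 𝒳 P) {M : D} (hM : P M) :
    ∃ (W M' : D) (i : M ⟶ W) (p : W ⟶ M'), W ∈ 𝒲 ∧ SE i p ∧
      ∃ P' : D → Prop, Step 𝒲 𝒳 P' ∧ P' M' := by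
  obtain ⟨-, X, K₁, j, q, hX, hjq, hK₁⟩ := hP M hM
  obtain ⟨W, X₁, a, b, hW, hX₁, hab⟩ := hcog X hX
  have := hjq.mono
  have := hab.mono
  have : Mono (j ≫ a) := mono_comp _ _
  have hc := SE.cokernel (j ≫ a)
  obtain ⟨x, y, hxy⟩ := third hjq hab hc
  refine ⟨W, _, j ≫ a, _, hW, hc,
    fun E => ∃ (K X : D) (x : K ⟶ E) (y : E ⟶ X), P K ∧ X ∈ 𝒳 ∧ SE x y, ?_,
    _, _, x, y, hK₁, hX₁, hxy⟩
  rintro E ⟨K, X, x, y, hK, hX, hxy⟩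
  obtain ⟨hKW, Y, K₁, j, q, hY, hjq, hK₁⟩ := hP K hK
  obtain ⟨W, X₁, a, b, hW, hX₁, hab⟩ := hcog Y hY
  have := hjq.mono
  have := hab.mono
  have : Mono (j ≫ a) := mono_comp _ _
  have hc := SE.cokernel (j ≫ a)
  obtain ⟨x', y', hxy'⟩ := third hjq hab hc
  obtain ⟨g, hg⟩ := hLP X hX W hW x y hxy (j ≫ a)
  obtain ⟨s, t, hst⟩ := pushSE hxy hc hg
  exact ⟨fun W' hW' => LP.ext hxy (hKW W' hW') (hLP X hX W' hW'),
    _, _, s, t, hsum (hsub hW) hX, hst, _, _, x', y', hK₁, hX₁, hxy'⟩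

lemma splice {𝒲 : Set D} {K Q : ℕ → D} (i : ∀ n, K n ⟶ Q n) (p : ∀ n, Q n ⟶ K (n + 1))
    (hQ : ∀ n, Q n ∈ 𝒲) (h : ∀ n, SE (i n) (p n)) (hK : ∀ n, ∀ W ∈ 𝒲, LP (K n) W) :
    MemProperCores 𝒲 (K 0) := by
  have hm := fun n => (h n).mono
  have he := fun n => (h n).epi
  have w0 : ∀ n, i n ≫ p n ≫ i (n + 1) = 0 := fun n => by
    rw [← Category.assoc, (h n).w, zero_comp]
  have w : ∀ n, (p n ≫ i (n + 1)) ≫ p (n + 1) ≫ i (n + 2) = 0 := fun n => by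
    rw [Category.assoc, w0, comp_zero]
  have ex0 : ∀ n, (ShortComplex.mk (i n) (p n ≫ i (n + 1)) (w0 n)).Exact := fun n => by
    refine ShortComplex.exact_of_f_is_kernel _ (KernelFork.IsLimit.ofι' _ _ fun {T} k hk => ?_)
    have hk' : k ≫ p n = 0 := by
      rw [← cancel_mono (i (n + 1))]
      simpa using hk
    exact ⟨((h n).ker k hk').choose, ((h n).ker k hk').choose_spec⟩
  have hex : ∀ n, ∀ W ∈ 𝒲, ∀ φ : Q n ⟶ W, i n ≫ φ = 0 →
      ∃ ψ : Q (n + 1) ⟶ W, (p n ≫ i (n + 1)) ≫ ψ = φ := fun n W hW φ hφ => by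
    obtain ⟨l, hl⟩ := (h n).coker φ hφ
    obtain ⟨g, hg⟩ := hK (n + 2) W hW _ _ (h (n + 1)) l
    exact ⟨g, by rw [Category.assoc, hg, hl]⟩
  refine ⟨Q, fun n => p n ≫ i (n + 1), i 0, hQ, ⟨w0 0, w, hm 0, ex0 0, fun n => ?_⟩,
    fun W hW => ⟨fun φ => hK 1 W hW _ _ (h 0) φ, hex 0 W hW, fun n φ hφ => ?_⟩⟩
  · let φ : ShortComplex.mk (p n ≫ i (n + 1)) (p (n + 1) ≫ i (n + 2)) (w n) ⟶
        ShortComplex.mk (i (n + 1)) (p (n + 1) ≫ i (n + 2)) (w0 (n + 1)) :=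
      { τ₁ := p n, τ₂ := 𝟙 _, τ₃ := 𝟙 _ }
    have : Epi φ.τ₁ := he n
    have : IsIso φ.τ₂ := by dsimp [φ]; infer_instance
    have : Mono φ.τ₃ := by dsimp [φ]; infer_instance
    exact (ShortComplex.exact_iff_of_epi_of_isIso_of_mono φ).2 (ex0 (n + 1))
  · refine hex (n + 1) W hW φ ?_
    rw [← cancel_epi (p n)]
    simpa using hφ

lemma build {𝒲 : Set D} {P : D → Prop} (hP : ∀ K, P K → (∀ W ∈ 𝒲, LP K W) ∧
    ∃ (X K' : D) (i : K ⟶ X) (p : X ⟶ K'), X ∈ 𝒲 ∧ SE i p ∧ P K') {M : D} (hM : P M) :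
    MemProperCores 𝒲 M := by
  choose h X K' i p hX hs hK' using hP
  let S : ℕ → {K // P K} := fun n => Nat.rec ⟨M, hM⟩ (fun _ k => ⟨K' k.1 k.2, hK' k.1 k.2⟩) n
  exact splice (K := fun n => (S n).1) (Q := fun n => X (S n).1 (S n).2)
    (fun n => i _ _) (fun n => p _ _) (fun n => hX _ _) (fun n => hs _ _) (fun n => h _ (S n).2)

lemma step_init {𝒲 𝒳 : Set D} (hsub : 𝒲 ⊆ 𝒳) (hLP : ∀ X ∈ 𝒳, ∀ W ∈ 𝒲, LP X W) :
    Step 𝒲 𝒳 (fun K => MemProperCores 𝒳 K ∧ ∀ W ∈ 𝒲, LP K W) := by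
  rintro K ⟨⟨Q, δ, η, hQ, hr, he⟩, hK⟩
  refine ⟨hK, Q 0, cokernel η, η, cokernel.π η, hQ 0, ?_, ⟨fun n => Q (n + 1), fun n => δ (n + 1),
    cokernel.desc η (δ 0) hr.w0, fun n => hQ _, ?_, ?_⟩, ?_⟩
  · have := hr.mono
    exact SE.cokernel η
  · have w0 : cokernel.desc η (δ 0) hr.w0 ≫ δ 1 = 0 := by
      rw [← cancel_epi (cokernel.π η)]
      simpa using hr.w 0
    refine ⟨w0, fun n => hr.w (n + 1), ?_, ?_, fun n => hr.exact (n + 1)⟩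
    · exact (ShortComplex.exact_iff_mono_cokernel_desc _).1 hr.exact0
    · let φ : ShortComplex.mk (δ 0) (δ 1) (hr.w 0) ⟶
          ShortComplex.mk (cokernel.desc η (δ 0) hr.w0) (δ 1) w0 :=
        { τ₁ := cokernel.π η, τ₂ := 𝟙 _, τ₃ := 𝟙 _ }
      have : Epi φ.τ₁ := by dsimp [φ]; infer_instance
      have : IsIso φ.τ₂ := by dsimp [φ]; infer_instance
      have : Mono φ.τ₃ := by dsimp [φ]; infer_instance
      exact (ShortComplex.exact_iff_of_epi_of_isIso_of_mono φ).1 (hr.exact 0)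
  · intro W hW
    obtain ⟨h0, h1, h2⟩ := he W hW
    refine ⟨fun φ => ?_, fun φ hφ => h2 0 φ ?_, fun n φ hφ => h2 (n + 1) φ hφ⟩
    · obtain ⟨ψ, hψ⟩ := h1 (cokernel.π η ≫ φ) (by simp)
      exact ⟨ψ, by rw [← cancel_epi (cokernel.π η), cokernel.π_desc_assoc, hψ]⟩
    · rw [← cokernel.π_desc η (δ 0) hr.w0, Category.assoc, hφ, comp_zero]
  · intro W hW
    have := hr.mono
    exact LP.quot (SE.cokernel η) (hLP _ (hQ 0) W hW) (he W (hsub hW)).1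

theorem main {𝒲 𝒳 : Set D} (hsub : 𝒲 ⊆ 𝒳) (hsum : SumClosed 𝒳)
    (hcog : ∀ X ∈ 𝒳, ∃ (W X' : D) (i : X ⟶ W) (p : W ⟶ X'), W ∈ 𝒲 ∧ X' ∈ 𝒳 ∧ SE i p)
    (hLP : ∀ X ∈ 𝒳, ∀ W ∈ 𝒲, LP X W) {M : D} (hM : MemProperCores 𝒳 M)
    (hMW : ∀ W ∈ 𝒲, LP M W) : MemProperCores 𝒲 M := by
  refine build (P := fun K => ∃ P : D → Prop, Step 𝒲 𝒳 P ∧ P K) ?_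
    ⟨_, step_init hsub hLP, hM, hMW⟩
  rintro K ⟨P, hP, hK⟩
  exact ⟨(hP K hK).1, step_improve hsub hsum hcog hLP hP hK⟩

lemma SE.op {A B E : D} {i : A ⟶ B} {p : B ⟶ E} (h : SE i p) : SE p.op i.op :=
  SE.of h.to.op

lemma SE.unop {A B E : Dᵒᵖ} {i : A ⟶ B} {p : B ⟶ E} (h : SE i p) : SE p.unop i.unop :=
  SE.of h.to.unop

lemma cores_op {𝒴 : Set D} {N : D} (h : MemProperRes 𝒴 N) :
    MemProperCores {Y : Dᵒᵖ | Y.unop ∈ 𝒴} (Opposite.op N) := by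
  obtain ⟨P, d, ε, hP, hr, he⟩ := h
  refine ⟨fun n => Opposite.op (P n), fun n => (d n).op, ε.op, hP, ⟨?_, ?_, ?_, ?_, ?_⟩, ?_⟩
  · rw [← op_comp, hr.w0, op_zero]
  · intro n
    rw [← op_comp, hr.w, op_zero]
  · have := hr.epi
    infer_instance
  · exact hr.exact0.op
  · exact fun n => (hr.exact n).op
  · intro W hW
    obtain ⟨h0, h1, h2⟩ := he _ hW
    refine ⟨fun φ => ?_, fun φ hφ => ?_, fun n φ hφ => ?_⟩
    · obtain ⟨ψ, hψ⟩ := h0 φ.unop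
      exact ⟨ψ.op, Quiver.Hom.unop_inj hψ⟩
    · obtain ⟨ψ, hψ⟩ := h1 φ.unop (Quiver.Hom.op_inj hφ)
      exact ⟨ψ.op, Quiver.Hom.unop_inj hψ⟩
    · obtain ⟨ψ, hψ⟩ := h2 n φ.unop (Quiver.Hom.op_inj hφ)
      exact ⟨ψ.op, Quiver.Hom.unop_inj hψ⟩

lemma res_unop {𝒴 : Set D} {N : D}
    (h : MemProperCores {Y : Dᵒᵖ | Y.unop ∈ 𝒴} (Opposite.op N)) : MemProperRes 𝒴 N := by
  obtain ⟨P, d, ε, hP, hr, he⟩ := h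
  refine ⟨fun n => (P n).unop, fun n => (d n).unop, ε.unop, hP, ⟨?_, ?_, ?_, ?_, ?_⟩, ?_⟩
  · exact Quiver.Hom.op_inj hr.w0
  · exact fun n => Quiver.Hom.op_inj (hr.w n)
  · have := hr.mono
    exact unop_epi_of_mono ε
  · exact hr.exact0.unop
  · exact fun n => (hr.exact n).unop
  · intro W hW
    obtain ⟨h0, h1, h2⟩ := he (Opposite.op W) hW
    refine ⟨fun φ => ?_, fun φ hφ => ?_, fun n φ hφ => ?_⟩
    · obtain ⟨ψ, hψ⟩ := h0 φ.op
      exact ⟨ψ.unop, Quiver.Hom.op_inj hψ⟩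
    · obtain ⟨ψ, hψ⟩ := h1 φ.op (Quiver.Hom.unop_inj hφ)
      exact ⟨ψ.unop, Quiver.Hom.op_inj hψ⟩
    · obtain ⟨ψ, hψ⟩ := h2 n φ.op (Quiver.Hom.unop_inj hφ)
      exact ⟨ψ.unop, Quiver.Hom.op_inj hψ⟩

lemma sum_op {𝒴 : Set D} (hi : IsoClosed 𝒴) (hs : SumClosed 𝒴) :
    SumClosed {Y : Dᵒᵖ | Y.unop ∈ 𝒴} := by
  intro A B hA hB
  refine hi (?_ : A.unop ⊞ B.unop ≅ (A ⊞ B).unop) (hs hA hB)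
  refine ⟨biprod.desc (biprod.fst : A ⊞ B ⟶ A).unop (biprod.snd : A ⊞ B ⟶ B).unop,
    biprod.lift (biprod.inl : A ⟶ A ⊞ B).unop (biprod.inr : B ⟶ A ⊞ B).unop, ?_, ?_⟩
  · apply biprod.hom_ext' <;> apply biprod.hom_ext <;> simp [← unop_comp]
  · rw [biprod.lift_desc]
    apply Quiver.Hom.op_inj
    simp only [op_add, op_comp, Quiver.Hom.op_unop, op_id]
    exact biprod.total

lemma LP_of_ext [HasExt.{w} D] {M W : D} (h : extPerp M W) : LP M W := by
  intro A B i p hip f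
  have := h 1 le_rfl
  obtain ⟨x, hx⟩ := Ext.contravariant_sequence_exact₁ hip.to W (Ext.mk₀ f) (add_zero 1)
    (Subsingleton.elim (α := Ext M W 1) _ _)
  obtain ⟨g, rfl⟩ := (Ext.mk₀_bijective _ _).2 x
  refine ⟨g, (Ext.mk₀_bijective _ _).1 ?_⟩
  rw [← hx, Ext.mk₀_comp_mk₀]

lemma LP_op_of_ext [HasExt.{w} D] {M W : D} (h : extPerp W M) :
    LP (Opposite.op M) (Opposite.op W) := by
  intro A B i p hip f
  have := h 1 le_rfl
  obtain ⟨x, hx⟩ := Ext.covariant_sequence_exact₃ W hip.unop.to (Ext.mk₀ f.unop) (zero_add 1)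
    (Subsingleton.elim (α := Ext W M 1) _ _)
  obtain ⟨g, rfl⟩ := (Ext.mk₀_bijective _ _).2 x
  refine ⟨g.op, Quiver.Hom.unop_inj ((Ext.mk₀_bijective _ _).1 ?_)⟩
  change Ext.mk₀ (g ≫ i.unop) = _
  rw [← hx, Ext.mk₀_comp_mk₀]

end

end Aux

variable [EnoughProjectives C] [EnoughInjectives C] [HasExt.{w} C]

/-- Lemma 2.2: (a) if `𝒲` is an injective cogenerator for `𝒳`,
`M ∈ cores~(𝒳)` and `M ⊥ 𝒲`, then `M ∈ cores~(𝒲)`; (b) dually, if `𝒱` is a projective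
generator for `𝒴`, `N ∈ res~(𝒴)` and `𝒱 ⊥ N`, then `N ∈ res~(𝒱)`. -/
theorem stmt_6 (𝒲 𝒳 𝒱 𝒴 : Set C)
    (h𝒲iso : IsoClosed 𝒲) (h𝒲sum : SumClosed 𝒲)
    (h𝒳iso : IsoClosed 𝒳) (h𝒳sum : SumClosed 𝒳)
    (h𝒱iso : IsoClosed 𝒱) (h𝒱sum : SumClosed 𝒱)
    (h𝒴iso : IsoClosed 𝒴) (h𝒴sum : SumClosed 𝒴) :
    (IsInjCogen 𝒲 𝒳 → ∀ M : C, MemProperCores 𝒳 M →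
        (∀ W ∈ 𝒲, extPerp M W) → MemProperCores 𝒲 M) ∧
    (IsProjGen 𝒱 𝒴 → ∀ N : C, MemProperRes 𝒴 N →
        (∀ V ∈ 𝒱, extPerp V N) → MemProperRes 𝒱 N) := by
  constructor
  · rintro ⟨⟨hsub, hcog⟩, hperp⟩ M hM hMW
    refine Aux.main hsub h𝒳sum ?_ (fun X hX W hW => Aux.LP_of_ext (hperp X hX W hW)) hM
      (fun W hW => Aux.LP_of_ext (hMW W hW))
    intro X hX
    obtain ⟨W, X', i, p, w, hW, hX', h⟩ := hcog X hX
    exact ⟨W, X', i, p, hW, hX', Aux.SE.of h⟩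
  · rintro ⟨⟨hsub, hgen⟩, hperp⟩ N hN hVN
    refine Aux.res_unop (Aux.main (𝒳 := {Y : Cᵒᵖ | Y.unop ∈ 𝒴}) (fun V hV => hsub hV)
      (Aux.sum_op h𝒴iso h𝒴sum) ?_ (fun X hX W hW => Aux.LP_op_of_ext (hperp _ hW _ hX))
      (Aux.cores_op hN) (fun W hW => Aux.LP_op_of_ext (hVN _ hW)))
    intro X hX
    obtain ⟨Y', V, i, p, w, hV, hY', h⟩ := hgen _ hX
    exact ⟨Opposite.op V, Opposite.op Y', p.op, i.op, hV, hY', (Aux.SE.of h).op⟩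
end

section
/- Let X be a subcategory of A and let 0 → M' → M → M'' → 0 be an exact sequence in A that is both Hom_A(X,−)-exact and Hom_A(−,X)-exact. If M' and M'' lie in G(X), then so does M. Furthermore, given complete X-resolutions X' of M' and X'' of M'', there is a degreewise split exact sequence of complexes 0 → X' → X → X'' → 0 such that X is a complete X-resolution of M, the induced sequence 0 → Coker(∂^{X'}_1) → Coker(∂^X_1) → Coker(∂^{X''}_1) → 0 is equivalent to the original sequence, and ∂^X_n = [[∂^{X'}_n, f_n],[0, ∂^{X''}_n]] for each n ∈ ℤ. -/
open CategoryTheory CategoryTheory.Limits CategoryTheory.Abelian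

universe w v u

variable {C : Type u} [Category.{v} C] [Abelian C]

theorem stmt9_int_rec (F : ℤ → Type v) (R : ∀ n, F n → F (n + 1) → Prop)
    (b : F 0) (c : F (0 + 1)) (hc : R 0 b c)
    (fw : ∀ n x y, R n x y → ∃ z, R (n + 1) y z)
    (bw : ∀ n y z, R (n + 1) y z → ∃ x, R n x y) :
    ∃ f : ∀ n, F n, (∀ n, R n (f n) (f (n + 1))) ∧ f 0 = b := by
  obtain ⟨a, hab⟩ := bw (Int.negSucc 0) b c hc
  choose fz hfz using fw
  choose bz hbz using bw
  let fwd : ∀ k : ℕ, {p : F (Int.ofNat k) × F (Int.ofNat k + 1) // R _ p.1 p.2} := fun k =>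
    Nat.rec (motive := fun k => {p : F (Int.ofNat k) × F (Int.ofNat k + 1) // R _ p.1 p.2})
      ⟨(b, c), hc⟩ (fun k p => ⟨(p.1.2, fz _ _ _ p.2), hfz _ _ _ p.2⟩) k
  let bwd : ∀ k : ℕ, {p : F (Int.negSucc k) × F (Int.negSucc k + 1) // R _ p.1 p.2} := fun k =>
    Nat.rec (motive := fun k => {p : F (Int.negSucc k) × F (Int.negSucc k + 1) // R _ p.1 p.2})
      ⟨(a, b), hab⟩
      (fun k p => ⟨(bz (Int.negSucc (k+1)) _ _ p.2, p.1.1), hbz (Int.negSucc (k+1)) _ _ p.2⟩) k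
  refine ⟨fun n => match n with
    | Int.ofNat k => (fwd k).1.1
    | Int.negSucc k => (bwd k).1.1, ?_, rfl⟩
  intro n
  match n with
  | Int.ofNat k => exact (fwd k).2
  | Int.negSucc 0 => exact (bwd 0).2
  | Int.negSucc (k+1) => exact (bwd (k+1)).2

theorem stmt9_tri_comp {A A' B B' D D' : C} (a : A ⟶ B) (b : A' ⟶ B) (c : A' ⟶ B')
    (a' : B ⟶ D) (b' : B' ⟶ D) (c' : B' ⟶ D') (h1 : a ≫ a' = 0) (h2 : b ≫ a' + c ≫ b' = 0)
    (h3 : c ≫ c' = 0) : triMat a b c ≫ triMat a' b' c' = 0 := by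
  unfold triMat
  ext <;> simp [h1, h2, h3]

theorem stmt9_lift (𝒳 : Set C)
    (X' : ℤ → C) (d' : ∀ n : ℤ, X' (n + 1) ⟶ X' n) (hX' : IsTotallyAcyclic 𝒳 X' d')
    (W : C) (hW : W ∈ 𝒳) (m : ℤ) (φ : W ⟶ cokernel (d' m)) :
    ∃ ψ : W ⟶ X' m, ψ ≫ cokernel.π (d' m) = φ := by
  obtain ⟨k, rfl⟩ : ∃ k, m = k + 1 + 1 := ⟨m - 2, by ring⟩
  have hm : Mono (cokernel.desc _ _ (hX'.w (k + 1))) := (hX'.exact (k + 1)).mono_cokernelDesc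
  obtain ⟨ψ, hψ⟩ := hX'.homExact W hW k (φ ≫ cokernel.desc _ _ (hX'.w (k + 1))) (by
    have : cokernel.desc _ _ (hX'.w (k + 1)) ≫ d' k = 0 := by
      ext; simp [hX'.w k]
    rw [Category.assoc, this, comp_zero])
  refine ⟨ψ, ?_⟩
  rw [← cancel_mono (cokernel.desc _ _ (hX'.w (k + 1))), ← hψ]
  simp

theorem stmt9_lift' (𝒳 : Set C)
    (X' : ℤ → C) (d' : ∀ n : ℤ, X' (n + 1) ⟶ X' n) (hX' : IsTotallyAcyclic 𝒳 X' d')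
    (W : C) (hW : W ∈ 𝒳) (m : ℤ) (φ : W ⟶ X' m) (h : φ ≫ cokernel.π (d' m) = 0) :
    ∃ ψ : W ⟶ X' (m + 1), ψ ≫ d' m = φ := by
  obtain ⟨k, rfl⟩ : ∃ k, m = k + 1 := ⟨m - 1, by ring⟩
  refine hX'.homExact W hW k φ ?_
  rw [← cokernel.π_desc _ _ (hX'.w k), reassoc_of% h, zero_comp]

theorem stmt9_total (𝒳 : Set C) (h𝒳sum : SumClosed 𝒳)
    (X' : ℤ → C) (d' : ∀ n : ℤ, X' (n + 1) ⟶ X' n) (hX' : IsTotallyAcyclic 𝒳 X' d')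
    (X'' : ℤ → C) (d'' : ∀ n : ℤ, X'' (n + 1) ⟶ X'' n) (hX'' : IsTotallyAcyclic 𝒳 X'' d'')
    (fn : ∀ n : ℤ, X'' (n + 1) ⟶ X' n)
    (hfn : ∀ n, fn (n + 1) ≫ d' n + d'' (n + 1) ≫ fn n = 0) :
    IsTotallyAcyclic 𝒳 (fun n => X' n ⊞ X'' n)
        (fun n => triMat (d' n) (fn n) (d'' n)) := by
  have hw := fun n => stmt9_tri_comp _ _ _ _ _ _ (hX'.w n) (hfn n) (hX''.w n)
  have hfn' : ∀ n, fn (n + 1) ≫ d' n = - (d'' (n + 1) ≫ fn n) :=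
    fun n => eq_neg_of_add_eq_zero_left (hfn n)
  refine ⟨fun n => h𝒳sum (hX'.mem n) (hX''.mem n), hw, ?_, ?_, ?_⟩
  · intro n
    rw [ShortComplex.exact_iff_exact_up_to_refinements]
    intro W φ hφ
    dsimp at φ hφ
    have h1 : (φ ≫ biprod.snd) ≫ d'' n = 0 := by
      simpa [triMat] using hφ =≫ biprod.snd
    have h2 : (φ ≫ biprod.fst) ≫ d' n + (φ ≫ biprod.snd) ≫ fn n = 0 := by
      simpa [triMat] using hφ =≫ biprod.fst
    obtain ⟨W₁, p, hp, β, hβ⟩ := (hX''.exact n).exact_up_to_refinements _ h1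
    dsimp at β hβ
    have h3 : (p ≫ φ ≫ biprod.fst - β ≫ fn (n+1)) ≫ d' n = 0 := by
      have := p ≫= h2
      simp only [Preadditive.comp_add, Category.assoc, reassoc_of% hβ] at this
      simpa [hfn'] using this
    obtain ⟨W₂, q, hq, α, hα⟩ := (hX'.exact n).exact_up_to_refinements _ h3
    dsimp at α hα
    refine ⟨W₂, q ≫ p, epi_comp _ _, biprod.lift α (q ≫ β), ?_⟩
    dsimp
    ext
    · simp [triMat, ← hα]
    · simp [triMat, hβ]
  · intro W hW n φ hφ
    have h1 : (φ ≫ biprod.snd) ≫ d'' n = 0 := by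
      simpa [triMat] using hφ =≫ biprod.snd
    have h2 : (φ ≫ biprod.fst) ≫ d' n + (φ ≫ biprod.snd) ≫ fn n = 0 := by
      simpa [triMat] using hφ =≫ biprod.fst
    obtain ⟨β, hβ⟩ := hX''.homExact W hW n _ h1
    have h3 : (φ ≫ biprod.fst - β ≫ fn (n+1)) ≫ d' n = 0 := by
      rw [← hβ] at h2
      simpa [hfn'] using h2
    obtain ⟨α, hα⟩ := hX'.homExact W hW n _ h3
    refine ⟨biprod.lift α β, ?_⟩
    ext
    · simp [triMat, hα]
    · simp [triMat, hβ]
  · intro W hW n φ hφ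
    have h1 : d' (n+1) ≫ biprod.inl ≫ φ = 0 := by
      have := biprod.inl ≫= hφ
      rw [← Category.assoc] at this ⊢
      rw [comp_zero] at this
      rw [← this]
      congr 1
      ext <;> simp [triMat]
    have h2 : fn (n+1) ≫ biprod.inl ≫ φ + d'' (n+1) ≫ biprod.inr ≫ φ = 0 := by
      have := biprod.inr ≫= hφ
      rw [comp_zero] at this
      rw [← this]
      simp only [← Category.assoc]
      rw [← Preadditive.add_comp]
      congr 1
      ext <;> simp [triMat]
    obtain ⟨α, hα⟩ := hX'.homExact' W hW n _ h1
    have h3 : d'' (n+1) ≫ (biprod.inr ≫ φ - fn n ≫ α) = 0 := by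
      rw [← hα, ← Category.assoc, hfn'] at h2
      rw [Preadditive.comp_sub, ← h2]
      simp only [Preadditive.neg_comp, Category.assoc]
      abel
    obtain ⟨β, hβ⟩ := hX''.homExact' W hW n _ h3
    refine ⟨biprod.desc α β, ?_⟩
    ext
    · simp [triMat, hα]
    · simp [triMat, hβ]

/-- Proposition 3.4, Horseshoe Lemma for complete resolutions: given a short
exact sequence `0 → M' → M → M'' → 0` that is `Hom(𝒳,-)`- and `Hom(-,𝒳)`-exact, with
complete `𝒳`-resolutions `X'` of `M'` and `X''` of `M''`, the object `M` lies in `G(𝒳)`,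
with complete resolution having terms `X'_n ⊞ X''_n`, upper triangular differential, and
induced sequence on cokernels equivalent to the original one. -/
theorem stmt_9 (𝒳 : Set C) (h𝒳iso : IsoClosed 𝒳) (h𝒳sum : SumClosed 𝒳)
    {M' M M'' : C} (f : M' ⟶ M) (g : M ⟶ M'') (w' : f ≫ g = 0)
    (hse : (ShortComplex.mk f g w').ShortExact)
    (hcov : ∀ W ∈ 𝒳, ∀ φ : W ⟶ M'', ∃ ψ : W ⟶ M, ψ ≫ g = φ)
    (hcontra : ∀ W ∈ 𝒳, ∀ φ : M' ⟶ W, ∃ ψ : M ⟶ W, f ≫ ψ = φ)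
    (X' : ℤ → C) (d' : ∀ n : ℤ, X' (n + 1) ⟶ X' n)
    (hX' : IsTotallyAcyclic 𝒳 X' d') (e' : cokernel (d' 0) ≅ M')
    (X'' : ℤ → C) (d'' : ∀ n : ℤ, X'' (n + 1) ⟶ X'' n)
    (hX'' : IsTotallyAcyclic 𝒳 X'' d'') (e'' : cokernel (d'' 0) ≅ M'') :
    M ∈ GorClass 𝒳 ∧
    ∃ (fn : ∀ n : ℤ, X'' (n + 1) ⟶ X' n),
      IsTotallyAcyclic 𝒳 (fun n => X' n ⊞ X'' n)
        (fun n => triMat (d' n) (fn n) (d'' n)) ∧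
      ∃ e : cokernel (triMat (d' 0) (fn 0) (d'' 0)) ≅ M,
        cokernel.π (d' 0) ≫ e'.hom ≫ f =
          biprod.inl ≫ cokernel.π (triMat (d' 0) (fn 0) (d'' 0)) ≫ e.hom ∧
        cokernel.π (triMat (d' 0) (fn 0) (d'' 0)) ≫ e.hom ≫ g =
          biprod.snd ≫ cokernel.π (d'' 0) ≫ e''.hom := by
  suffices h : ∃ (fn : ∀ n : ℤ, X'' (n + 1) ⟶ X' n),
      IsTotallyAcyclic 𝒳 (fun n => X' n ⊞ X'' n)
        (fun n => triMat (d' n) (fn n) (d'' n)) ∧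
      ∃ e : cokernel (triMat (d' 0) (fn 0) (d'' 0)) ≅ M,
        cokernel.π (d' 0) ≫ e'.hom ≫ f =
          biprod.inl ≫ cokernel.π (triMat (d' 0) (fn 0) (d'' 0)) ≫ e.hom ∧
        cokernel.π (triMat (d' 0) (fn 0) (d'' 0)) ≫ e.hom ≫ g =
          biprod.snd ≫ cokernel.π (d'' 0) ≫ e''.hom by
    refine ⟨?_, h⟩
    obtain ⟨fn, h1, e, -⟩ := h
    exact ⟨_, _, h1, ⟨e⟩⟩
  have hmono : Mono f := hse.mono_f
  have hepi : Epi g := hse.epi_g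
  -- the projection and the embedding of the kernel term
  obtain ⟨p', hp'⟩ : ∃ p' : X' 0 ⟶ M', p' = cokernel.π (d' 0) ≫ e'.hom := ⟨_, rfl⟩
  obtain ⟨p'', hp''⟩ : ∃ p'' : X'' 0 ⟶ M'', p'' = cokernel.π (d'' 0) ≫ e''.hom := ⟨_, rfl⟩
  have hp'epi : Epi p' := by rw [hp']; infer_instance
  have hp''epi : Epi p'' := by rw [hp'']; infer_instance
  have hdp' : d' 0 ≫ p' = 0 := by simp [hp']
  have hdp'' : d'' 0 ≫ p'' = 0 := by simp [hp'']
  have hex' : (ShortComplex.mk (d' 0) p' hdp').Exact := by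
    refine ShortComplex.exact_of_g_is_cokernel _ ?_
    exact IsColimit.ofIsoColimit (cokernelIsCokernel (d' 0))
      (Cofork.ext e' (by simp [hp']))
  have hex'' : (ShortComplex.mk (d'' 0) p'' hdp'').Exact := by
    refine ShortComplex.exact_of_g_is_cokernel _ ?_
    exact IsColimit.ofIsoColimit (cokernelIsCokernel (d'' 0))
      (Cofork.ext e'' (by simp [hp'']))
  have hlift : ∀ W ∈ 𝒳, ∀ φ : W ⟶ M', ∃ ψ : W ⟶ X' 0, ψ ≫ p' = φ := by
    intro W hW φ
    obtain ⟨ψ, hψ⟩ := stmt9_lift 𝒳 X' d' hX' W hW 0 (φ ≫ e'.inv)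
    exact ⟨ψ, by rw [hp', reassoc_of% hψ]; simp⟩
  obtain ⟨s, hs⟩ := hcov _ (hX''.mem 0) p''
  obtain ⟨u, hu⟩ : ∃ u : X'' (0 + 1) ⟶ M', u ≫ f = - (d'' 0 ≫ s) := by
    have : (-(d'' 0 ≫ s)) ≫ g = 0 := by simp [hs, hdp'']
    exact ⟨hse.exact.lift _ this, hse.exact.lift_f _ this⟩
  obtain ⟨f0, hf0⟩ := hlift _ (hX''.mem _) u
  have hf0' : f0 ≫ p' ≫ f + d'' 0 ≫ s = 0 := by
    rw [← Category.assoc, hf0, hu]; simp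
  obtain ⟨f1, hf1⟩ := stmt9_lift' 𝒳 X' d' hX' _ (hX''.mem (0 + 1 + 1)) 0
    (-(d'' (0 + 1) ≫ f0)) (by
      have h6 := eq_neg_of_add_eq_zero_left hf0'
      have h7 : (-(d'' (0 + 1) ≫ f0)) ≫ p' = 0 := by
        rw [← cancel_mono f]
        have h8 := hX''.w 0
        simp only [Preadditive.neg_comp, Category.assoc, h6, Preadditive.comp_neg, neg_neg,
          zero_comp, reassoc_of% h8]
      rw [← cancel_mono e'.hom, Category.assoc, ← hp', h7, zero_comp])
  obtain ⟨fn, hfn, hfn0⟩ := stmt9_int_rec (fun n => (X'' (n + 1) ⟶ X' n))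
    (fun n x y => y ≫ d' n + d'' (n + 1) ≫ x = 0) f0 f1 (by rw [hf1]; simp)
    (by
      intro n x y h
      obtain ⟨z, hz⟩ := hX'.homExact _ (hX''.mem (n + 1 + 1 + 1)) n (-(d'' (n+1+1) ≫ y)) (by
        have h' := eq_neg_of_add_eq_zero_left h
        have := hX''.w (n+1)
        simp [h', reassoc_of% this])
      exact ⟨z, by simp [hz]⟩)
    (by
      intro n y z h
      obtain ⟨x, hx⟩ := hX''.homExact' _ (hX'.mem n) (n+1) (-(y ≫ d' n)) (by
        have h' := eq_neg_of_add_eq_zero_right h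
        have := hX'.w n
        rw [Preadditive.comp_neg, ← Category.assoc, h']
        simp [this])
      exact ⟨x, by simp [hx]⟩)
  refine ⟨fn, stmt9_total 𝒳 h𝒳sum X' d' hX' X'' d'' hX'' fn hfn, ?_⟩
  rw [hfn0]
  have hz : triMat (d' 0) f0 (d'' 0) ≫ biprod.desc (p' ≫ f) s = 0 := by
    unfold triMat
    rw [biprod.lift_desc]
    ext
    · simp [reassoc_of% hdp']
    · simpa using hf0'
  have hE : (ShortComplex.mk _ _ hz).Exact := by
    rw [ShortComplex.exact_iff_exact_up_to_refinements]
    intro W φ hφ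
    dsimp at φ hφ
    have h0 : (φ ≫ biprod.fst) ≫ p' ≫ f + (φ ≫ biprod.snd) ≫ s = 0 := by
      rw [← hφ, biprod.desc_eq]; simp
    have h1 : (φ ≫ biprod.snd) ≫ p'' = 0 := by
      have := h0 =≫ g
      simpa [w', hs] using this
    obtain ⟨W₁, p, hp, β, hβ⟩ := hex''.exact_up_to_refinements _ h1
    dsimp at β hβ
    have h3 : (p ≫ φ ≫ biprod.fst - β ≫ f0) ≫ p' = 0 := by
      have := p ≫= h0
      simp only [Preadditive.comp_add, Category.assoc, reassoc_of% hβ] at this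
      rw [← cancel_mono f]
      have h5 := eq_neg_of_add_eq_zero_left hf0'
      simpa [h5] using this
    obtain ⟨W₂, q, hq, α, hα⟩ := hex'.exact_up_to_refinements _ h3
    dsimp at α hα
    refine ⟨W₂, q ≫ p, epi_comp _ _, biprod.lift α (q ≫ β), ?_⟩
    dsimp
    ext
    · simp [triMat, ← hα]
    · simp [triMat, hβ]
  have hEpi : Epi (biprod.desc (p' ≫ f) s) := by
    rw [Preadditive.epi_iff_cancel_zero]
    intro Z r hr
    have h1 : f ≫ r = 0 := by
      have := biprod.inl ≫= hr
      rw [← cancel_epi p']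
      simpa using this
    have h2 : s ≫ r = 0 := by
      have := biprod.inr ≫= hr
      simpa using this
    have h3 : g ≫ hse.exact.desc r h1 = r := hse.exact.g_desc r h1
    have h4 : hse.exact.desc r h1 = 0 := by
      rw [← cancel_epi p'', ← hs, Category.assoc]
      exact (s ≫= h3).trans (by rw [h2, comp_zero])
    rw [← h3, h4, comp_zero]
  let e : cokernel (triMat (d' 0) f0 (d'' 0)) ≅ M :=
    (cokernelIsCokernel _).coconePointUniqueUpToIso hE.gIsCokernel
  have he : cokernel.π (triMat (d' 0) f0 (d'' 0)) ≫ e.hom = biprod.desc (p' ≫ f) s :=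
    (cokernelIsCokernel _).comp_coconePointUniqueUpToIso_hom hE.gIsCokernel WalkingParallelPair.one
  refine ⟨e, ?_, ?_⟩
  · rw [he]; simp [hp']
  · rw [← Category.assoc, he, ← hp'']
    ext
    · simp [w']
    · simp [hs]
end

section
/- If W is a subcategory of A with W ⊥ W, then the Gorenstein subcategory G(W) is closed under extensions: for every exact sequence 0 → M' → M → M'' → 0 in A with M' and M'' in G(W), the object M lies in G(W). -/
open CategoryTheory CategoryTheory.Limits CategoryTheory.Abelian

universe w v u

variable {C : Type u} [Category.{v} C] [Abelian C]

section Helpers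

/-- `0 → A → B → D → 0` is short exact. -/
def SEx {D : Type*} [Category D] [Abelian D] {X Y Z : D} (f : X ⟶ Y) (g : Y ⟶ Z) : Prop :=
  ∃ w : f ≫ g = 0, (ShortComplex.mk f g w).ShortExact

lemma SEx.op' {D : Type*} [Category D] [Abelian D] {X Y Z : D} {f : X ⟶ Y} {g : Y ⟶ Z}
    (h : SEx f g) : SEx g.op f.op := by
  obtain ⟨w, h⟩ := h
  exact ⟨_, h.op⟩

lemma SEx.unop' {D : Type*} [Category D] [Abelian D] {X Y Z : Dᵒᵖ} {f : X ⟶ Y} {g : Y ⟶ Z}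
    (h : SEx f g) : SEx g.unop f.unop := by
  obtain ⟨w, h⟩ := h
  exact ⟨_, h.unop⟩

lemma nine_ker {D : Type*} [Category D] [Abelian D] {K' X' M' K'' X'' M'' B M : D}
    {j : X' ⟶ B} {q : B ⟶ X''} (hjq : SEx j q) {f : M' ⟶ M} {g : M ⟶ M''} (hfg : SEx f g)
    {i' : K' ⟶ X'} {p' : X' ⟶ M'} (h' : SEx i' p')
    {i'' : K'' ⟶ X''} {p'' : X'' ⟶ M''} (h'' : SEx i'' p'')
    (p : B ⟶ M) (c1 : j ≫ p = p' ≫ f) (c2 : p ≫ g = q ≫ p'') :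
    ∃ (K : D) (i : K ⟶ B) (a : K' ⟶ K) (b : K ⟶ K''), SEx i p ∧ SEx a b := by
  obtain ⟨w1, hjq⟩ := hjq
  obtain ⟨w2, hfg⟩ := hfg
  obtain ⟨w3, h'⟩ := h'
  obtain ⟨w4, h''⟩ := h''
  have := hjq.mono_f; have := hjq.epi_g; have := hfg.mono_f; have := hfg.epi_g
  have := h'.mono_f; have := h'.epi_g; have := h''.mono_f; have := h''.epi_g
  dsimp at *
  have hp : Epi p := by
    rw [epi_iff_surjective_up_to_refinements]
    intro A y
    obtain ⟨A1, π1, _, x1, e1⟩ := surjective_up_to_refinements_of_epi p'' (y ≫ g)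
    obtain ⟨A2, π2, _, x2, e2⟩ := surjective_up_to_refinements_of_epi q x1
    obtain ⟨A3, π3, _, x3, e3⟩ := hfg.exact.exact_up_to_refinements
      (π2 ≫ π1 ≫ y - x2 ≫ p) (by
        simp [c2, e1, reassoc_of% e2])
    dsimp at x3 e3
    obtain ⟨A4, π4, _, x4, e4⟩ := surjective_up_to_refinements_of_epi p' x3
    refine ⟨A4, π4 ≫ π3 ≫ π2 ≫ π1, inferInstance, π4 ≫ π3 ≫ x2 + x4 ≫ j, ?_⟩
    have := π4 ≫= e3
    simp only [Preadditive.comp_sub, reassoc_of% e4] at this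
    simp only [Preadditive.add_comp, Category.assoc, c1, ← this]
    abel
  have wa : (i' ≫ j) ≫ p = 0 := by simp [c1, reassoc_of% w3]
  have wb : (kernel.ι p ≫ q) ≫ p'' = 0 := by simp [← c2]
  let b : kernel p ⟶ K'' := h''.exact.lift (kernel.ι p ≫ q) wb
  have hb : b ≫ i'' = kernel.ι p ≫ q := h''.exact.lift_f _ _
  have ha : kernel.lift p (i' ≫ j) wa ≫ kernel.ι p = i' ≫ j := kernel.lift_ι _ _ _
  refine ⟨kernel p, kernel.ι p, kernel.lift p (i' ≫ j) wa, b, ⟨kernel.condition p, ?_⟩, ?_, ?_⟩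
  · exact ShortComplex.ShortExact.mk' (ShortComplex.exact_kernel p) inferInstance hp
  · rw [← cancel_mono i'', Category.assoc, hb, reassoc_of% ha]
    simp [w1]
  · refine ShortComplex.ShortExact.mk' ?_ ?_ ?_
    · rw [ShortComplex.exact_iff_exact_up_to_refinements]
      intro A x hx
      dsimp at x hx
      obtain ⟨A1, π1, _, x1, e1⟩ := hjq.exact.exact_up_to_refinements (x ≫ kernel.ι p) (by
        dsimp
        rw [Category.assoc, ← hb, reassoc_of% hx, zero_comp])
      dsimp at x1 e1
      obtain ⟨A2, π2, _, x2, e2⟩ := h'.exact.exact_up_to_refinements x1 (by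
        dsimp
        rw [← cancel_mono f, Category.assoc, ← c1, ← reassoc_of% e1]
        simp)
      dsimp at x2 e2
      refine ⟨A2, π2 ≫ π1, inferInstance, x2, ?_⟩
      dsimp
      rw [← cancel_mono (kernel.ι p)]
      simp [e1, reassoc_of% e2]
    · exact mono_of_mono_fac (h := i' ≫ j) ha
    · dsimp
      rw [epi_iff_surjective_up_to_refinements]
      intro A y
      obtain ⟨A1, π1, _, x1, e1⟩ := surjective_up_to_refinements_of_epi q (y ≫ i'')
      obtain ⟨A2, π2, _, x2, e2⟩ := hfg.exact.exact_up_to_refinements (x1 ≫ p) (by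
        dsimp
        rw [Category.assoc, c2, ← reassoc_of% e1, w4]
        simp)
      dsimp at x2 e2
      obtain ⟨A3, π3, _, x3, e3⟩ := surjective_up_to_refinements_of_epi p' x2
      refine ⟨A3, π3 ≫ π2 ≫ π1, inferInstance,
        kernel.lift p (π3 ≫ π2 ≫ x1 - x3 ≫ j) (by
          simp [c1, e2, reassoc_of% e3]), ?_⟩
      rw [← cancel_mono i'']
      simp [hb, e1, w1]

lemma nine_coker {D : Type*} [Category D] [Abelian D] {K' X' M' K'' X'' M'' B M : D}
    {j : X' ⟶ B} {q : B ⟶ X''} (hjq : SEx j q) {f : M' ⟶ M} {g : M ⟶ M''} (hfg : SEx f g)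
    {i' : M' ⟶ X'} {p' : X' ⟶ K'} (h' : SEx i' p')
    {i'' : M'' ⟶ X''} {p'' : X'' ⟶ K''} (h'' : SEx i'' p'')
    (i : M ⟶ B) (c1 : f ≫ i = i' ≫ j) (c2 : i ≫ q = g ≫ i'') :
    ∃ (K : D) (p : B ⟶ K) (a : K' ⟶ K) (b : K ⟶ K''), SEx i p ∧ SEx a b := by
  obtain ⟨K, k, a, b, h1, h2⟩ := nine_ker hjq.op' hfg.op' h''.op' h'.op' i.op
    (by rw [← op_comp, c2, op_comp]) (by rw [← op_comp, c1, op_comp])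
  exact ⟨K.unop, k.unop, b.unop, a.unop, h1.unop', h2.unop'⟩

lemma SEx_biprod (X Y : C) : SEx (biprod.inl : X ⟶ X ⊞ Y) (biprod.snd : X ⊞ Y ⟶ Y) :=
  ⟨by simp, (ShortComplex.Splitting.ofHasBinaryBiproduct X Y).shortExact⟩

section
variable [HasExt.{w} C]

lemma lift_of_ext {X Y Z W : C} {f : X ⟶ Y} {g : Y ⟶ Z} (h : SEx f g)
    (hW : Subsingleton (Ext.{w} W X 1)) (φ : W ⟶ Z) : ∃ ψ : W ⟶ Y, ψ ≫ g = φ := by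
  obtain ⟨w0, h⟩ := h
  obtain ⟨x, hx⟩ := Ext.covariant_sequence_exact₃ W h (Ext.mk₀ φ) (zero_add 1)
    (hW.elim _ _)
  obtain ⟨ψ, rfl⟩ := Ext.homEquiv₀.symm.surjective x
  refine ⟨ψ, Ext.homEquiv₀.symm.injective ?_⟩
  simpa using hx

lemma extend_of_ext {X Y Z W : C} {f : X ⟶ Y} {g : Y ⟶ Z} (h : SEx f g)
    (hW : Subsingleton (Ext.{w} Z W 1)) (φ : X ⟶ W) : ∃ ψ : Y ⟶ W, f ≫ ψ = φ := by
  obtain ⟨w0, h⟩ := h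
  obtain ⟨x, hx⟩ := Ext.contravariant_sequence_exact₁ h W (Ext.mk₀ φ) (add_zero 1)
    (hW.elim _ _)
  obtain ⟨ψ, rfl⟩ := Ext.homEquiv₀.symm.surjective x
  refine ⟨ψ, Ext.homEquiv₀.symm.injective ?_⟩
  simpa using hx

lemma ext_of_lift {X Y Z W : C} {f : X ⟶ Y} {g : Y ⟶ Z} (h : SEx f g)
    (hW : Subsingleton (Ext.{w} W Y 1)) (hl : ∀ φ : W ⟶ Z, ∃ ψ : W ⟶ Y, ψ ≫ g = φ) :
    Subsingleton (Ext.{w} W X 1) := by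
  obtain ⟨w0, h⟩ := h
  refine subsingleton_of_forall_eq 0 fun x => ?_
  obtain ⟨y, rfl⟩ := Ext.covariant_sequence_exact₁ W h x (hW.elim _ _) (zero_add 1)
  obtain ⟨φ, rfl⟩ := Ext.homEquiv₀.symm.surjective y
  obtain ⟨ψ, rfl⟩ := hl φ
  have : Ext.homEquiv₀.symm (ψ ≫ g) = (Ext.mk₀ ψ).comp (Ext.mk₀ g) (add_zero 0) := by
    simp
  rw [this, Ext.comp_assoc_of_second_deg_zero]
  have := h.comp_extClass
  dsimp at this
  rw [this, Ext.comp_zero]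

lemma ext_of_extend {X Y Z W : C} {f : X ⟶ Y} {g : Y ⟶ Z} (h : SEx f g)
    (hW : Subsingleton (Ext.{w} Y W 1)) (hl : ∀ φ : X ⟶ W, ∃ ψ : Y ⟶ W, f ≫ ψ = φ) :
    Subsingleton (Ext.{w} Z W 1) := by
  obtain ⟨w0, h⟩ := h
  refine subsingleton_of_forall_eq 0 fun x => ?_
  obtain ⟨y, rfl⟩ := Ext.contravariant_sequence_exact₃ h W x (hW.elim _ _) (add_zero 1)
  obtain ⟨φ, rfl⟩ := Ext.homEquiv₀.symm.surjective y
  obtain ⟨ψ, rfl⟩ := hl φ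
  have : Ext.homEquiv₀.symm (f ≫ ψ) = (Ext.mk₀ f).comp (Ext.mk₀ ψ) (add_zero 0) := by
    simp
  rw [this]
  exact h.extClass_comp_assoc _

lemma ext_mid_right {X Y Z W : C} {f : X ⟶ Y} {g : Y ⟶ Z} (h : SEx f g)
    (h1 : Subsingleton (Ext.{w} W X 1)) (h3 : Subsingleton (Ext.{w} W Z 1)) :
    Subsingleton (Ext.{w} W Y 1) := by
  obtain ⟨w0, h⟩ := h
  refine subsingleton_of_forall_eq 0 fun x => ?_
  obtain ⟨y, rfl⟩ := Ext.covariant_sequence_exact₂ W h x (h3.elim _ _)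
  rw [h1.elim y 0, Ext.zero_comp]

lemma ext_mid_left {X Y Z W : C} {f : X ⟶ Y} {g : Y ⟶ Z} (h : SEx f g)
    (h1 : Subsingleton (Ext.{w} X W 1)) (h3 : Subsingleton (Ext.{w} Z W 1)) :
    Subsingleton (Ext.{w} Y W 1) := by
  obtain ⟨w0, h⟩ := h
  refine subsingleton_of_forall_eq 0 fun x => ?_
  obtain ⟨y, rfl⟩ := Ext.contravariant_sequence_exact₂ h W x (h1.elim _ _)
  rw [h3.elim y 0, Ext.comp_zero]

/-- `𝒮` is closed under taking suitable syzygies and cosyzygies in `𝒲`. -/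
structure Coind (𝒲 𝒮 : Set C) : Prop where
  syz : ∀ M ∈ 𝒮, ∃ K ∈ 𝒮, ∃ X ∈ 𝒲, ∃ (i : K ⟶ X) (p : X ⟶ M), SEx i p
  cosyz : ∀ M ∈ 𝒮, ∃ K ∈ 𝒮, ∃ X ∈ 𝒲, ∃ (i : M ⟶ X) (p : X ⟶ K), SEx i p
  ext_right : ∀ M ∈ 𝒮, ∀ W ∈ 𝒲, Subsingleton (Ext.{w} W M 1)
  ext_left : ∀ M ∈ 𝒮, ∀ W ∈ 𝒲, Subsingleton (Ext.{w} M W 1)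

lemma exists_int_chain {α : Type*} (R : α → α → Prop) (hr : ∀ a, ∃ b, R a b)
    (hl : ∀ a, ∃ b, R b a) (a : α) : ∃ z : ℤ → α, z 0 = a ∧ ∀ n, R (z n) (z (n + 1)) := by
  choose r hr using hr
  choose l hl using hl
  refine ⟨fun n => match n with
    | Int.ofNat n => r^[n] a
    | Int.negSucc n => l^[n + 1] a, rfl, ?_⟩
  rintro (n | _ | n)
  · have : Int.ofNat n + 1 = Int.ofNat (n + 1) := rfl
    rw [this]
    simp only [Function.iterate_succ_apply']
    exact hr _
  · exact hl _
  · have : Int.negSucc (n + 1) + 1 = Int.negSucc n := rfl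
    rw [this]
    simp only [Function.iterate_succ_apply' l (n + 1)]
    exact hl _

lemma Coind.subset {𝒲 𝒮 : Set C} (h : Coind.{w} 𝒲 𝒮) {M : C} (hM : M ∈ 𝒮) :
    M ∈ GorClass 𝒲 := by
  obtain ⟨z, hz0, hz⟩ := exists_int_chain
    (fun A B : 𝒮 => ∃ X ∈ 𝒲, ∃ (i : B.1 ⟶ X) (p : X ⟶ A.1), SEx i p)
    (fun A => by
      obtain ⟨K, hK, X, hX, i, p, hip⟩ := h.syz A.1 A.2
      exact ⟨⟨K, hK⟩, X, hX, i, p, hip⟩)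
    (fun A => by
      obtain ⟨K, hK, X, hX, i, p, hip⟩ := h.cosyz A.1 A.2
      exact ⟨⟨K, hK⟩, X, hX, i, p, hip⟩) ⟨M, hM⟩
  choose X hX i p hip using hz
  have hm : ∀ n, Mono (i n) := fun n => (hip n).2.mono_f
  have he : ∀ n, Epi (p n) := fun n => (hip n).2.epi_g
  have hw : ∀ n, i n ≫ p n = 0 := fun n => (hip n).1
  refine ⟨X, fun n => p (n + 1) ≫ i n, ⟨hX, ?_, ?_, ?_, ?_⟩, ?_⟩
  · intro n
    simp [reassoc_of% (hw (n + 1))]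
  · intro n
    rw [ShortComplex.exact_iff_exact_up_to_refinements]
    intro A x hx
    dsimp at x hx
    obtain ⟨A1, π1, _, x1, e1⟩ := (hip (n + 1)).2.exact.exact_up_to_refinements x (by
      dsimp
      rw [← cancel_mono (i n)]
      simpa using hx)
    dsimp at x1 e1
    obtain ⟨A2, π2, _, x2, e2⟩ := surjective_up_to_refinements_of_epi (p (n + 1 + 1)) x1
    refine ⟨A2, π2 ≫ π1, inferInstance, x2, ?_⟩
    simp [e1, reassoc_of% e2]
  · intro W hW n φ hφ
    have h0 : φ ≫ p (n + 1) = 0 := by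
      rw [← cancel_mono (i n)]
      simpa using hφ
    obtain ⟨ψ, hψ⟩ := lift_of_ext (hip (n + 1 + 1)) (h.ext_right _ (z _).2 W hW)
      ((hip (n + 1)).2.exact.lift φ h0)
    refine ⟨ψ, ?_⟩
    rw [← Category.assoc, hψ]
    exact (hip (n + 1)).2.exact.lift_f φ h0
  · intro W hW n φ hφ
    have h0 : i (n + 1) ≫ φ = 0 := by
      rw [← cancel_epi (p (n + 1 + 1))]
      simpa using hφ
    obtain ⟨ψ, hψ⟩ := extend_of_ext (hip n) (h.ext_left _ (z _).2 W hW)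
      ((hip (n + 1)).2.exact.desc φ h0)
    refine ⟨ψ, ?_⟩
    rw [Category.assoc, hψ]
    exact (hip (n + 1)).2.exact.g_desc φ h0
  · have e : (z 0).1 = M := by rw [hz0]
    refine ⟨cokernelEpiComp _ _ ≪≫ ?_ ≪≫ eqToIso e⟩
    exact (cokernelIsCokernel (i 0)).coconePointUniqueUpToIso (hip 0).2.gIsCokernel

/-- Cokernels in any degree of totally acyclic complexes. -/
def GorAny (𝒲 : Set C) : Set C :=
  {M | ∃ (X : ℤ → C) (d : ∀ n : ℤ, X (n + 1) ⟶ X n),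
    IsTotallyAcyclic 𝒲 X d ∧ ∃ n, Nonempty (cokernel (d n) ≅ M)}

lemma SEx.of_iso_right {X Y Z Z' : C} {f : X ⟶ Y} {g : Y ⟶ Z} (h : SEx f g) (e : Z ≅ Z') :
    SEx f (g ≫ e.hom) := by
  obtain ⟨w0, h⟩ := h
  exact ⟨by simp [reassoc_of% w0], ShortComplex.shortExact_of_iso (S₁ := ShortComplex.mk f g w0)
    (ShortComplex.isoMk (Iso.refl _) (Iso.refl _) e (by simp) (by simp)) h⟩

lemma SEx.of_iso_left {X X' Y Z : C} {f : X ⟶ Y} {g : Y ⟶ Z} (h : SEx f g) (e : X ≅ X') :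
    SEx (e.inv ≫ f) g := by
  obtain ⟨w0, h⟩ := h
  exact ⟨by simp [w0], ShortComplex.shortExact_of_iso (S₁ := ShortComplex.mk f g w0)
    (ShortComplex.isoMk e (Iso.refl _) (Iso.refl _) (by simp) (by simp)) h⟩

section
variable {𝒲 : Set C} {X : ℤ → C} {d : ∀ n : ℤ, X (n + 1) ⟶ X n}

lemma IsTotallyAcyclic.sEx (h : IsTotallyAcyclic 𝒲 X d) (n : ℤ) :
    SEx (cokernel.desc (d (n + 1)) (d n) (h.w n)) (cokernel.π (d n)) := by
  have hm : Mono (cokernel.desc (d (n + 1)) (d n) (h.w n)) := (h.exact n).mono_cokernelDesc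
  have w0 : cokernel.desc (d (n + 1)) (d n) (h.w n) ≫ cokernel.π (d n) = 0 := by
    rw [← cancel_epi (cokernel.π (d (n + 1)))]
    simp
  refine ⟨w0, ShortComplex.ShortExact.mk' ?_ hm inferInstance⟩
  rw [ShortComplex.exact_iff_exact_up_to_refinements]
  intro A x hx
  obtain ⟨A1, π1, _, x1, e1⟩ := (ShortComplex.exact_cokernel (d n)).exact_up_to_refinements x hx
  dsimp at x1 e1
  exact ⟨A1, π1, inferInstance, x1 ≫ cokernel.π _, by simp [e1]⟩

lemma IsTotallyAcyclic.lift (h : IsTotallyAcyclic 𝒲 X d) (n : ℤ) {W : C} (hW : W ∈ 𝒲)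
    (φ : W ⟶ cokernel (d n)) : ∃ ψ : W ⟶ X n, ψ ≫ cokernel.π (d n) = φ := by
  obtain ⟨k, rfl⟩ : ∃ k, n = k + 1 + 1 := ⟨n - 2, by ring⟩
  have := (h.sEx (k + 1)).2.mono_f
  dsimp at this
  obtain ⟨ψ, hψ⟩ := h.homExact W hW k (φ ≫ cokernel.desc _ _ (h.w (k + 1))) (by
    have : cokernel.desc _ _ (h.w (k + 1)) ≫ d k = 0 := by
      rw [← cancel_epi (cokernel.π _)]
      simp [h.w k]
    rw [Category.assoc, this, comp_zero])
  refine ⟨ψ, ?_⟩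
  rw [← cancel_mono (cokernel.desc _ _ (h.w (k + 1)))]
  simpa using hψ

lemma IsTotallyAcyclic.extend (h : IsTotallyAcyclic 𝒲 X d) (n : ℤ) {W : C} (hW : W ∈ 𝒲)
    (φ : cokernel (d (n + 1)) ⟶ W) :
    ∃ ψ : X n ⟶ W, cokernel.desc (d (n + 1)) (d n) (h.w n) ≫ ψ = φ := by
  obtain ⟨ψ, hψ⟩ := h.homExact' W hW n (cokernel.π _ ≫ φ) (by simp)
  refine ⟨ψ, ?_⟩
  rw [← cancel_epi (cokernel.π _)]
  simpa using hψ

end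

lemma coind_gorAny {𝒲 : Set C} (hperp : ∀ W ∈ 𝒲, ∀ W' ∈ 𝒲, extPerp.{w} W W') :
    Coind.{w} 𝒲 (GorAny 𝒲) where
  syz := by
    rintro M ⟨X, d, h, n, ⟨e⟩⟩
    exact ⟨_, ⟨X, d, h, n + 1, ⟨Iso.refl _⟩⟩, X n, h.mem n, _, _, (h.sEx n).of_iso_right e⟩
  cosyz := by
    rintro M ⟨X, d, h, n, ⟨e⟩⟩
    obtain ⟨k, rfl⟩ : ∃ k, n = k + 1 := ⟨n - 1, by ring⟩
    exact ⟨_, ⟨X, d, h, k, ⟨Iso.refl _⟩⟩, X k, h.mem k, _, _, (h.sEx k).of_iso_left e⟩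
  ext_right := by
    rintro M ⟨X, d, h, n, ⟨e⟩⟩ W hW
    obtain ⟨k, rfl⟩ : ∃ k, n = k + 1 := ⟨n - 1, by ring⟩
    refine ext_of_lift ((h.sEx k).of_iso_left e) (hperp W hW _ (h.mem k) 1 le_rfl) ?_
    exact h.lift k hW
  ext_left := by
    rintro M ⟨X, d, h, n, ⟨e⟩⟩ W hW
    refine ext_of_extend ((h.sEx n).of_iso_right e) (hperp _ (h.mem n) W hW 1 le_rfl) ?_
    exact h.extend n hW

/-- Extensions of objects of `𝒮`. -/
def ExtOf (𝒮 : Set C) : Set C :=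
  {M | ∃ M' ∈ 𝒮, ∃ M'' ∈ 𝒮, ∃ (f : M' ⟶ M) (g : M ⟶ M''), SEx f g}

lemma Coind.extOf {𝒲 𝒮 : Set C} (hsum : SumClosed 𝒲) (h : Coind.{w} 𝒲 𝒮) :
    Coind.{w} 𝒲 (ExtOf 𝒮) where
  syz := by
    rintro M ⟨M', hM', M'', hM'', f, g, hfg⟩
    obtain ⟨K', hK', X', hX', i', p', h'⟩ := h.syz M' hM'
    obtain ⟨K'', hK'', X'', hX'', i'', p'', h''⟩ := h.syz M'' hM''
    obtain ⟨l, hl⟩ := lift_of_ext hfg (h.ext_right _ hM' _ hX'') p''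
    obtain ⟨K, i, a, b, h1, h2⟩ := nine_ker (SEx_biprod X' X'') hfg h' h''
      (biprod.desc (p' ≫ f) l) (by simp) (by
        ext
        · simp [hfg.1]
        · simp [hl])
    exact ⟨K, ⟨K', hK', K'', hK'', a, b, h2⟩, _, hsum hX' hX'', _, _, h1⟩
  cosyz := by
    rintro M ⟨M', hM', M'', hM'', f, g, hfg⟩
    obtain ⟨K', hK', X', hX', i', p', h'⟩ := h.cosyz M' hM'
    obtain ⟨K'', hK'', X'', hX'', i'', p'', h''⟩ := h.cosyz M'' hM''
    obtain ⟨l, hl⟩ := extend_of_ext hfg (h.ext_left _ hM'' _ hX') i'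
    obtain ⟨K, i, a, b, h1, h2⟩ := nine_coker (SEx_biprod X' X'') hfg h' h''
      (biprod.lift l (g ≫ i'')) (by
        ext
        · simp [hl]
        · simp [reassoc_of% hfg.1]) (by simp)
    exact ⟨K, ⟨K', hK', K'', hK'', a, b, h2⟩, _, hsum hX' hX'', _, _, h1⟩
  ext_right := by
    rintro M ⟨M', hM', M'', hM'', f, g, hfg⟩ W hW
    exact ext_mid_right hfg (h.ext_right _ hM' W hW) (h.ext_right _ hM'' W hW)
  ext_left := by
    rintro M ⟨M', hM', M'', hM'', f, g, hfg⟩ W hW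
    exact ext_mid_left hfg (h.ext_left _ hM' W hW) (h.ext_left _ hM'' W hW)

end

end Helpers

variable [EnoughProjectives C] [EnoughInjectives C] [HasExt.{w} C]

/-- Corollary 3.5: if `𝒲 ⊥ 𝒲`, then `G(𝒲)` is closed under extensions. -/
theorem stmt_10 (𝒲 : Set C) (h𝒲iso : IsoClosed 𝒲) (h𝒲sum : SumClosed 𝒲)
    (hperp : ∀ W ∈ 𝒲, ∀ W' ∈ 𝒲, extPerp W W')
    {M' M M'' : C} (f : M' ⟶ M) (g : M ⟶ M'') (w' : f ≫ g = 0)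
    (hse : (ShortComplex.mk f g w').ShortExact)
    (hM' : M' ∈ GorClass 𝒲) (hM'' : M'' ∈ GorClass 𝒲) :
    M ∈ GorClass 𝒲 := by
  obtain ⟨X', d', h', e'⟩ := hM'
  obtain ⟨X'', d'', h'', e''⟩ := hM''
  exact ((coind_gorAny hperp).extOf h𝒲sum).subset
    ⟨M', ⟨X', d', h', 0, e'⟩, M'', ⟨X'', d'', h'', 0, e''⟩, f, g, w', hse⟩
end

section
/- Fix an integer n ≥ 1. (a) If W is an injective cogenerator for X and G^n(X) is closed under extensions, then W is an injective cogenerator for G^n(X). (b) If V is a projective generator for Y and G^n(Y) is closed under extensions, then V is a projective generator for G^n(Y). -/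
open CategoryTheory CategoryTheory.Limits CategoryTheory.Abelian

universe w v u

variable {C : Type u} [Category.{v} C] [Abelian C]

namespace GorAux

/-- Differentials with flexible indices. -/
def dd {X : ℤ → C} (d : ∀ n : ℤ, X (n + 1) ⟶ X n) (a b : ℤ) (h : a = b + 1) : X a ⟶ X b :=
  eqToHom (by rw [h]) ≫ d b

lemma dd_self {X : ℤ → C} (d : ∀ n : ℤ, X (n + 1) ⟶ X n) (b : ℤ) :
    dd d (b + 1) b rfl = d b := by simp [dd]

lemma ta_shift {𝒳 : Set C} {X : ℤ → C} {d : ∀ n : ℤ, X (n + 1) ⟶ X n}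
    (h : IsTotallyAcyclic 𝒳 X d) (m : ℤ) :
    IsTotallyAcyclic 𝒳 (fun n => X (n + m))
      (fun n => dd d (n + 1 + m) (n + m) (by ring)) := by
  have w : ∀ (a b c : ℤ) (h1 : a = b + 1) (h2 : b = c + 1), dd d a b h1 ≫ dd d b c h2 = 0 := by
    intro a b c h1 h2
    subst h2; subst h1
    simpa [dd] using h.w c
  refine ⟨fun n => h.mem _, fun n => w _ _ _ _ _, fun n => ?_, ?_, ?_⟩
  · have : ∀ (a b c : ℤ) (h1 : a = b + 1) (h2 : b = c + 1),
      (ShortComplex.mk (dd d a b h1) (dd d b c h2) (w _ _ _ _ _)).Exact := by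
      intro a b c h1 h2
      subst h2; subst h1
      simpa only [dd_self] using h.exact c
    exact this _ _ _ _ _
  · intro W hW n φ hφ
    have : ∀ (a b c : ℤ) (h1 : a = b + 1) (h2 : b = c + 1) (φ : W ⟶ X b),
        φ ≫ dd d b c h2 = 0 → ∃ ψ : W ⟶ X a, ψ ≫ dd d a b h1 = φ := by
      intro a b c h1 h2
      subst h2; subst h1
      simpa only [dd_self] using h.homExact W hW c
    exact this _ _ _ _ _ φ hφ
  · intro W hW n φ hφ
    have : ∀ (a b c : ℤ) (h1 : a = b + 1) (h2 : b = c + 1) (φ : X b ⟶ W),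
        dd d a b h1 ≫ φ = 0 → ∃ ψ : X c ⟶ W, dd d b c h2 ≫ ψ = φ := by
      intro a b c h1 h2
      subst h2; subst h1
      simpa only [dd_self] using h.homExact' W hW c
    exact this _ _ _ _ _ φ hφ

lemma dd_coker {X : ℤ → C} (d : ∀ n : ℤ, X (n + 1) ⟶ X n) (a b m : ℤ) (h : a = b + 1)
    (hb : b = m) : Nonempty (cokernel (dd d a b h) ≅ cokernel (d m)) := by
  subst hb; subst h
  rw [dd_self]
  exact ⟨Iso.refl _⟩

lemma coker_mem {𝒳 : Set C} {X : ℤ → C} {d : ∀ n : ℤ, X (n + 1) ⟶ X n}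
    (h : IsTotallyAcyclic 𝒳 X d) (m : ℤ) : cokernel (d m) ∈ GorClass 𝒳 :=
  ⟨_, _, ta_shift h m, dd_coker d _ _ _ _ (by ring)⟩

lemma exists_ta {𝒳 : Set C} {M : C} (hM : M ∈ GorClass 𝒳) (k : ℤ) :
    ∃ (X : ℤ → C) (d : ∀ n : ℤ, X (n + 1) ⟶ X n),
      IsTotallyAcyclic 𝒳 X d ∧ Nonempty (cokernel (d k) ≅ M) := by
  obtain ⟨X, d, h, ⟨e⟩⟩ := hM
  obtain ⟨e'⟩ := dd_coker d (k + 1 + -k) (k + -k) 0 (by ring) (by ring)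
  exact ⟨_, _, ta_shift h (-k), ⟨e' ≪≫ e⟩⟩

lemma gor_iso {𝒳 : Set C} : IsoClosed (GorClass 𝒳) := by
  rintro A B e ⟨X, d, h, ⟨e'⟩⟩
  exact ⟨X, d, h, ⟨e' ≪≫ e⟩⟩

lemma mem_of_exact {𝒳 : Set C} {X : ℤ → C} {d : ∀ n : ℤ, X (n + 1) ⟶ X n}
    (h : IsTotallyAcyclic 𝒳 X d) {M : C} (g : X 0 ⟶ M) (w : d 0 ≫ g = 0) (hg : Epi g)
    (he : (ShortComplex.mk (d 0) g w).Exact) : M ∈ GorClass 𝒳 := by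
  have : Epi (ShortComplex.mk (d 0) g w).g := hg
  exact ⟨X, d, h, ⟨(colimit.isColimit _).coconePointUniqueUpToIso he.gIsCokernel⟩⟩

lemma coker_ses {𝒳 : Set C} {X : ℤ → C} {d : ∀ n : ℤ, X (n + 1) ⟶ X n}
    (h : IsTotallyAcyclic 𝒳 X d) (m : ℤ) :
    ∃ w : cokernel.desc (d (m + 1)) (d m) (h.w m) ≫ cokernel.π (d m) = 0,
      (ShortComplex.mk _ _ w).ShortExact := by
  refine ⟨by simp [← cancel_epi (cokernel.π (d (m+1)))], ?_⟩
  have h1 : Mono (cokernel.desc (d (m + 1)) (d m) (h.w m)) := (h.exact m).mono_cokernelDesc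
  refine ShortComplex.ShortExact.mk' ?_ h1 (by dsimp; infer_instance)
  rw [ShortComplex.exact_iff_exact_up_to_refinements]
  intro A x hx
  obtain ⟨A', π, hπ, y, hy⟩ := (ShortComplex.exact_cokernel (d m)).exact_up_to_refinements x hx
  exact ⟨A', π, hπ, y ≫ cokernel.π _, by simpa using hy⟩

lemma gor_left {𝒳 : Set C} {M : C} (hM : M ∈ GorClass 𝒳) :
    ∃ (K X : C) (f : K ⟶ X) (g : X ⟶ M) (w : f ≫ g = 0), K ∈ GorClass 𝒳 ∧ X ∈ 𝒳 ∧
      (ShortComplex.mk f g w).ShortExact ∧ ∀ W ∈ 𝒳, ∀ φ : K ⟶ W, ∃ ψ : X ⟶ W, f ≫ ψ = φ := by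
  obtain ⟨X, d, h, ⟨e⟩⟩ := exists_ta hM 0
  obtain ⟨w, hs⟩ := coker_ses h 0
  refine ⟨_, X 0, cokernel.desc (d (0 + 1)) (d 0) (h.w 0), cokernel.π (d 0) ≫ e.hom,
    by rw [reassoc_of% w, zero_comp], coker_mem h _, h.mem _, ?_, ?_⟩
  · exact ShortComplex.shortExact_of_iso
      (ShortComplex.isoMk (S₁ := ShortComplex.mk _ _ w)
        (Iso.refl _) (Iso.refl _) e (by simp) (by simp)) hs
  · intro W hW φ
    obtain ⟨ψ, hψ⟩ := h.homExact' W hW 0 (cokernel.π _ ≫ φ) (by simp)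
    exact ⟨ψ, by simp [← cancel_epi (cokernel.π (d (0+1))), hψ]⟩

lemma gor_right {𝒳 : Set C} {M : C} (hM : M ∈ GorClass 𝒳) :
    ∃ (X K : C) (f : M ⟶ X) (g : X ⟶ K) (w : f ≫ g = 0), K ∈ GorClass 𝒳 ∧ X ∈ 𝒳 ∧
      (ShortComplex.mk f g w).ShortExact ∧ ∀ W ∈ 𝒳, ∀ φ : W ⟶ K, ∃ ψ : W ⟶ X, ψ ≫ g = φ := by
  obtain ⟨X, d, h, ⟨e⟩⟩ := exists_ta hM (0 + 1 + 1 + 1)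
  obtain ⟨w, hs⟩ := coker_ses h (0 + 1 + 1)
  refine ⟨X (0 + 1 + 1), _, e.inv ≫ cokernel.desc (d (0 + 1 + 1 + 1)) (d (0 + 1 + 1)) (h.w _),
    cokernel.π (d (0 + 1 + 1)),
    by rw [Category.assoc, w, comp_zero], coker_mem h _, h.mem _, ?_, ?_⟩
  · exact ShortComplex.shortExact_of_iso
      (ShortComplex.isoMk (S₁ := ShortComplex.mk _ _ w)
        e (Iso.refl _) (Iso.refl _) (by simp) (by simp)) hs
  · intro W hW φ
    have : Mono (cokernel.desc (d (0 + 1 + 1)) (d (0 + 1)) (h.w _)) :=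
      (h.exact _).mono_cokernelDesc
    have hz : cokernel.desc (d (0 + 1 + 1)) (d (0 + 1)) (h.w _) ≫ d 0 = 0 := by
      rw [← cancel_epi (cokernel.π (d (0+1+1))), cokernel.π_desc_assoc, h.w, comp_zero]
    obtain ⟨ψ, hψ⟩ := h.homExact W hW 0
      (φ ≫ cokernel.desc (d (0 + 1 + 1)) (d (0 + 1)) (h.w _)) (by rw [Category.assoc, hz, comp_zero])
    refine ⟨ψ, ?_⟩
    rw [← cancel_mono (cokernel.desc (d (0 + 1 + 1)) (d (0 + 1)) (h.w _))]
    simpa using hψ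

lemma biprod_exact {A B D A' B' D' : C} (f : A ⟶ B) (g : B ⟶ D) (f' : A' ⟶ B') (g' : B' ⟶ D')
    (w : f ≫ g = 0) (w' : f' ≫ g' = 0) (h : (ShortComplex.mk f g w).Exact)
    (h' : (ShortComplex.mk f' g' w').Exact)
    (w'' : biprod.map f f' ≫ biprod.map g g' = 0) :
    (ShortComplex.mk (biprod.map f f') (biprod.map g g') w'').Exact := by
  rw [ShortComplex.exact_iff_exact_up_to_refinements]
  intro T x hx
  dsimp at x hx
  have h1 : (x ≫ biprod.fst) ≫ g = 0 := by simpa using hx =≫ biprod.fst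
  have h2 : (x ≫ biprod.snd) ≫ g' = 0 := by simpa using hx =≫ biprod.snd
  obtain ⟨T₁, π₁, hπ₁, y₁, hy₁⟩ := h.exact_up_to_refinements (x ≫ biprod.fst) h1
  obtain ⟨T₂, π₂, hπ₂, y₂, hy₂⟩ := h'.exact_up_to_refinements (π₁ ≫ x ≫ biprod.snd)
    (by simp at h2; simp [h2])
  dsimp at y₁ y₂ hy₁ hy₂
  refine ⟨T₂, π₂ ≫ π₁, epi_comp _ _, biprod.lift (π₂ ≫ y₁) y₂, ?_⟩
  dsimp
  ext
  · simp [hy₁]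
  · simp [hy₂]

lemma gor_sum {𝒳 : Set C} (hs : SumClosed 𝒳) : SumClosed (GorClass 𝒳) := by
  rintro A B ⟨X, d, h, ⟨e⟩⟩ ⟨X', d', h', ⟨e'⟩⟩
  have hT : IsTotallyAcyclic 𝒳 (fun n => X n ⊞ X' n) (fun n => biprod.map (d n) (d' n)) := by
    have w : ∀ n, biprod.map (d (n+1)) (d' (n+1)) ≫ biprod.map (d n) (d' n) = 0 := by
      intro n
      ext <;> simp [h.w, h'.w]
    refine ⟨fun n => hs (h.mem n) (h'.mem n), w,
      fun n => biprod_exact _ _ _ _ _ _ (h.exact n) (h'.exact n) _, ?_, ?_⟩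
    · intro W hW n φ hφ
      obtain ⟨a, ha⟩ := h.homExact W hW n (φ ≫ biprod.fst) (by simpa using hφ =≫ biprod.fst)
      obtain ⟨b, hb⟩ := h'.homExact W hW n (φ ≫ biprod.snd) (by simpa using hφ =≫ biprod.snd)
      exact ⟨biprod.lift a b, by ext <;> simp [ha, hb]⟩
    · intro W hW n φ hφ
      obtain ⟨a, ha⟩ := h.homExact' W hW n (biprod.inl ≫ φ) (by simpa using biprod.inl ≫= hφ)
      obtain ⟨b, hb⟩ := h'.homExact' W hW n (biprod.inr ≫ φ) (by simpa using biprod.inr ≫= hφ)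
      exact ⟨biprod.desc a b, by ext <;> simp [ha, hb]⟩
  have hw : biprod.map (d 0) (d' 0) ≫ biprod.map (cokernel.π (d 0)) (cokernel.π (d' 0)) = 0 := by
    ext <;> simp
  refine gor_iso (biprod.mapIso e e') (mem_of_exact hT
    (biprod.map (cokernel.π (d 0)) (cokernel.π (d' 0))) hw inferInstance ?_)
  exact biprod_exact _ _ _ _ _ _ (ShortComplex.exact_cokernel _) (ShortComplex.exact_cokernel _) _

lemma sub_gor {𝒳 : Set C} (hs : SumClosed 𝒳) : 𝒳 ⊆ GorClass 𝒳 := by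
  intro A hA
  have hT : IsTotallyAcyclic 𝒳 (fun _ => A ⊞ A)
      (fun _ => (biprod.snd : A ⊞ A ⟶ A) ≫ biprod.inl) := by
    refine ⟨fun _ => hs hA hA, by simp, fun n => ?_, ?_, ?_⟩
    · rw [ShortComplex.exact_iff_exact_up_to_refinements]
      intro T x hx
      dsimp at x hx
      have h2 : x ≫ biprod.snd = 0 := by simpa using hx =≫ biprod.fst
      refine ⟨T, 𝟙 T, inferInstance, biprod.lift 0 (x ≫ biprod.fst), ?_⟩
      dsimp
      ext <;> simp [h2]
    · intro W hW n x hx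
      have h2 : x ≫ biprod.snd = 0 := by simpa using hx =≫ biprod.fst
      refine ⟨biprod.lift 0 (x ≫ biprod.fst), ?_⟩
      ext <;> simp [h2]
    · intro W hW n x hx
      have h2 : biprod.inl ≫ x = 0 := by simpa using biprod.inr ≫= hx
      refine ⟨biprod.desc (biprod.inr ≫ x) 0, ?_⟩
      ext <;> simp [h2]
  refine mem_of_exact hT (biprod.snd : A ⊞ A ⟶ A) (by simp) inferInstance ?_
  rw [ShortComplex.exact_iff_exact_up_to_refinements]
  intro T x hx
  dsimp at x hx
  refine ⟨T, 𝟙 T, inferInstance, biprod.lift 0 (x ≫ biprod.fst), ?_⟩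
  dsimp
  ext <;> simp [hx]

lemma iter_sum {𝒳 : Set C} (hs : SumClosed 𝒳) : ∀ n, SumClosed (GorIter 𝒳 n)
  | 0 => hs
  | n + 1 => gor_sum (iter_sum hs n)

lemma iter_mono {𝒳 : Set C} (hs : SumClosed 𝒳) : Monotone (GorIter 𝒳) :=
  monotone_nat_of_le_succ fun n => sub_gor (iter_sum hs n)

lemma comp_mono_ext {M G M' W U : C} {f : M ⟶ G} {g : G ⟶ M'} {w : f ≫ g = 0}
    (h : (ShortComplex.mk f g w).ShortExact) {i : G ⟶ W} {p : W ⟶ U} {w' : i ≫ p = 0}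
    (h' : (ShortComplex.mk i p w').ShortExact) :
    ∃ (a : M' ⟶ cokernel (f ≫ i)) (b : cokernel (f ≫ i) ⟶ U) (w'' : a ≫ b = 0),
      (ShortComplex.mk a b w'').ShortExact := by
  have := h.mono_f
  have := h.epi_g
  have := h'.mono_f
  have := h'.epi_g
  dsimp at *
  obtain ⟨a, ha⟩ : ∃ a : M' ⟶ cokernel (f ≫ i), g ≫ a = i ≫ cokernel.π (f ≫ i) :=
    ⟨h.exact.desc (i ≫ cokernel.π (f ≫ i)) (by
      have := cokernel.condition (f ≫ i)
      rwa [Category.assoc] at this), h.exact.g_desc _ _⟩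
  obtain ⟨b, hb⟩ : ∃ b : cokernel (f ≫ i) ⟶ U, cokernel.π (f ≫ i) ≫ b = p :=
    ⟨cokernel.desc _ p (by simp [w']), by simp⟩
  have w'' : a ≫ b = 0 := by
    rw [← cancel_epi g, reassoc_of% ha, hb, w', comp_zero]
  have hbe : Epi b := by
    have : Epi (cokernel.π (f ≫ i) ≫ b) := by rw [hb]; infer_instance
    exact epi_of_epi (cokernel.π (f ≫ i)) b
  refine ⟨a, b, w'', ShortComplex.ShortExact.mk' ?_ ?_ hbe⟩
  · rw [ShortComplex.exact_iff_exact_up_to_refinements]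
    intro T x hx
    dsimp at x hx
    obtain ⟨T₁, π₁, hπ₁, y, hy⟩ := surjective_up_to_refinements_of_epi (cokernel.π (f ≫ i)) x
    obtain ⟨T₂, π₂, hπ₂, z, hz⟩ := h'.exact.exact_up_to_refinements y (by
      have : y ≫ cokernel.π (f ≫ i) ≫ b = 0 := by rw [← reassoc_of% hy, hx, comp_zero]
      rwa [hb] at this)
    dsimp at z hz
    refine ⟨T₂, π₂ ≫ π₁, epi_comp _ _, z ≫ g, ?_⟩
    dsimp
    rw [Category.assoc, Category.assoc, hy, reassoc_of% hz, ha]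
  · dsimp
    refine Preadditive.mono_of_cancel_zero _ fun {T} x hx => ?_
    obtain ⟨T₁, π₁, hπ₁, y, hy⟩ := surjective_up_to_refinements_of_epi g x
    obtain ⟨T₂, π₂, hπ₂, z, hz⟩ :=
      (ShortComplex.exact_cokernel (f ≫ i)).exact_up_to_refinements (y ≫ i) (by
        dsimp
        rw [Category.assoc, ← ha, ← reassoc_of% hy, hx, comp_zero])
    dsimp at z hz
    have hz' : π₂ ≫ y = z ≫ f := by
      rw [← cancel_mono i]; simpa using hz
    rw [← cancel_epi π₁, ← cancel_epi π₂, hy, reassoc_of% hz', w]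
    simp

lemma comp_epi_ext {M G M' V U : C} {f : M' ⟶ G} {g : G ⟶ M} {w : f ≫ g = 0}
    (h : (ShortComplex.mk f g w).ShortExact) {i : U ⟶ V} {p : V ⟶ G} {w' : i ≫ p = 0}
    (h' : (ShortComplex.mk i p w').ShortExact) :
    ∃ (a : U ⟶ kernel (p ≫ g)) (b : kernel (p ≫ g) ⟶ M') (w'' : a ≫ b = 0),
      (ShortComplex.mk a b w'').ShortExact := by
  have := h.mono_f
  have := h.epi_g
  have := h'.mono_f
  have := h'.epi_g
  dsimp at *
  obtain ⟨b, hb⟩ : ∃ b : kernel (p ≫ g) ⟶ M', b ≫ f = kernel.ι (p ≫ g) ≫ p :=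
    ⟨h.exact.lift (kernel.ι (p ≫ g) ≫ p) (by
      have := kernel.condition (p ≫ g)
      rwa [← Category.assoc] at this), h.exact.lift_f _ _⟩
  obtain ⟨a, ha⟩ : ∃ a : U ⟶ kernel (p ≫ g), a ≫ kernel.ι (p ≫ g) = i :=
    ⟨kernel.lift _ i (by rw [reassoc_of% w', zero_comp]), by simp⟩
  have w'' : a ≫ b = 0 := by
    rw [← cancel_mono f, Category.assoc, hb, reassoc_of% ha, w', zero_comp]
  have ham : Mono a := by
    have : Mono (a ≫ kernel.ι (p ≫ g)) := by rw [ha]; infer_instance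
    exact mono_of_mono a (kernel.ι (p ≫ g))
  refine ⟨a, b, w'', ShortComplex.ShortExact.mk' ?_ ham ?_⟩
  · rw [ShortComplex.exact_iff_exact_up_to_refinements]
    intro T x hx
    dsimp at x hx
    obtain ⟨T₂, π₂, hπ₂, z, hz⟩ := h'.exact.exact_up_to_refinements (x ≫ kernel.ι (p ≫ g)) (by
      dsimp
      rw [Category.assoc, ← hb, reassoc_of% hx, zero_comp])
    dsimp at z hz
    refine ⟨T₂, π₂, hπ₂, z, ?_⟩
    dsimp
    rw [← cancel_mono (kernel.ι (p ≫ g)), Category.assoc, Category.assoc, hz, ha]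
  · dsimp
    rw [epi_iff_surjective_up_to_refinements]
    intro T y
    obtain ⟨T₁, π₁, hπ₁, z, hz⟩ := surjective_up_to_refinements_of_epi p (y ≫ f)
    refine ⟨T₁, π₁, hπ₁, kernel.lift _ z (by rw [← reassoc_of% hz, w]; simp), ?_⟩
    rw [← cancel_mono f]
    simp [hb, hz]

section

variable [HasExt.{w} C]

lemma perp_left {𝒢 : Set C} {W : C} (hW : W ∈ 𝒢) (h : ∀ X ∈ 𝒢, extPerp X W) :
    ∀ M ∈ GorClass 𝒢, extPerp M W := by
  suffices H : ∀ i : ℕ, ∀ M ∈ GorClass 𝒢, ∀ x : Abelian.Ext M W (1 + i), x = 0 by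
    intro M hM i hi
    obtain ⟨j, rfl⟩ := Nat.exists_eq_add_of_le hi
    exact ⟨fun x y => (H j M hM x).trans (H j M hM y).symm⟩
  intro i
  induction i with
  | zero =>
    intro M hM x
    obtain ⟨K, X, f, g, w, hK, hX, hS, hf⟩ := gor_left hM
    have := h X hX (1 + 0) (by omega)
    obtain ⟨y, hy⟩ := Ext.contravariant_sequence_exact₃ hS W x (Subsingleton.elim _ _)
      (n₀ := 0) rfl
    obtain ⟨φ, rfl⟩ := (Ext.mk₀_bijective _ _).2 y
    obtain ⟨ψ, rfl⟩ := hf W hW φ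
    rw [← hy, ← Ext.mk₀_comp_mk₀]
    exact hS.extClass_comp_assoc _
  | succ i ih =>
    intro M hM x
    obtain ⟨K, X, f, g, w, hK, hX, hS, hf⟩ := gor_left hM
    have := h X hX (1 + (i + 1)) (by omega)
    obtain ⟨y, hy⟩ := Ext.contravariant_sequence_exact₃ hS W x (Subsingleton.elim _ _)
      (n₀ := 1 + i) (by omega)
    rw [← hy, ih K hK y, Ext.comp_zero]

lemma perp_right {𝒢 : Set C} {V : C} (hV : V ∈ 𝒢) (h : ∀ X ∈ 𝒢, extPerp V X) :
    ∀ M ∈ GorClass 𝒢, extPerp V M := by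
  suffices H : ∀ i : ℕ, ∀ M ∈ GorClass 𝒢, ∀ x : Abelian.Ext V M (1 + i), x = 0 by
    intro M hM i hi
    obtain ⟨j, rfl⟩ := Nat.exists_eq_add_of_le hi
    exact ⟨fun x y => (H j M hM x).trans (H j M hM y).symm⟩
  intro i
  induction i with
  | zero =>
    intro M hM x
    obtain ⟨X, K, f, g, w, hK, hX, hS, hf⟩ := gor_right hM
    have := h X hX (1 + 0) (by omega)
    obtain ⟨y, hy⟩ := Ext.covariant_sequence_exact₁ V hS x (Subsingleton.elim _ _)
      (n₀ := 0) rfl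
    obtain ⟨φ, rfl⟩ := (Ext.mk₀_bijective _ _).2 y
    obtain ⟨ψ, rfl⟩ := hf V hV φ
    rw [← hy, ← Ext.mk₀_comp_mk₀, Ext.comp_assoc_of_second_deg_zero]
    have : (Ext.mk₀ g).comp hS.extClass (zero_add 1) = 0 := hS.comp_extClass
    rw [this, Ext.comp_zero]
  | succ i ih =>
    intro M hM x
    obtain ⟨X, K, f, g, w, hK, hX, hS, hf⟩ := gor_right hM
    have := h X hX (1 + (i + 1)) (by omega)
    obtain ⟨y, hy⟩ := Ext.covariant_sequence_exact₁ V hS x (Subsingleton.elim _ _)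
      (n₀ := 1 + i) (by omega)
    rw [← hy, ih K hK y, Ext.zero_comp]

lemma partA {𝒲 𝒳 : Set C} (hs : SumClosed 𝒳) (n : ℕ) (h : IsInjCogen 𝒲 𝒳)
    (he : ExtensionClosed (GorIter 𝒳 n)) : IsInjCogen 𝒲 (GorIter 𝒳 n) := by
  have hsub : ∀ k, 𝒲 ⊆ GorIter 𝒳 k := fun k =>
    h.1.1.trans (iter_mono hs (Nat.zero_le k))
  refine ⟨⟨hsub n, ?_⟩, ?_⟩
  · have key : ∀ k ≤ n, ∀ M ∈ GorIter 𝒳 k,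
        ∃ (W X' : C) (i : M ⟶ W) (p : W ⟶ X') (w : i ≫ p = 0),
          W ∈ 𝒲 ∧ X' ∈ GorIter 𝒳 n ∧ (ShortComplex.mk i p w).ShortExact := by
      intro k
      induction k with
      | zero =>
        intro _ M hM
        obtain ⟨W, X', i, p, w, hW, hX', hS⟩ := h.1.2 M hM
        exact ⟨W, X', i, p, w, hW, iter_mono hs (Nat.zero_le n) hX', hS⟩
      | succ k ih =>
        intro hk M hM
        obtain ⟨G, M', f, g, w, hM', hG, hS, -⟩ := gor_right hM
        obtain ⟨W, U, i, p, w', hW, hU, hS'⟩ := ih (by omega) G hG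
        obtain ⟨a, b, w'', hab⟩ := comp_mono_ext hS hS'
        have := hS.mono_f
        have := hS'.mono_f
        dsimp at *
        refine ⟨W, cokernel (f ≫ i), f ≫ i, cokernel.π _, cokernel.condition _, hW,
          he a b w'' hab (iter_mono hs hk hM') hU,
          ShortComplex.ShortExact.mk' (ShortComplex.exact_cokernel _) (mono_comp f i)
            (by dsimp; infer_instance)⟩
    exact key n le_rfl
  · intro M hM W hW
    have : ∀ k, ∀ M ∈ GorIter 𝒳 k, extPerp M W := by
      intro k
      induction k with
      | zero => exact fun M hM => h.2 M hM W hW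
      | succ k ih => exact perp_left (hsub k hW) ih
    exact this n M hM

lemma partB {𝒱 𝒴 : Set C} (hs : SumClosed 𝒴) (n : ℕ) (h : IsProjGen 𝒱 𝒴)
    (he : ExtensionClosed (GorIter 𝒴 n)) : IsProjGen 𝒱 (GorIter 𝒴 n) := by
  have hsub : ∀ k, 𝒱 ⊆ GorIter 𝒴 k := fun k =>
    h.1.1.trans (iter_mono hs (Nat.zero_le k))
  refine ⟨⟨hsub n, ?_⟩, ?_⟩
  · have key : ∀ k ≤ n, ∀ M ∈ GorIter 𝒴 k,
        ∃ (Y' V : C) (i : Y' ⟶ V) (p : V ⟶ M) (w : i ≫ p = 0),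
          V ∈ 𝒱 ∧ Y' ∈ GorIter 𝒴 n ∧ (ShortComplex.mk i p w).ShortExact := by
      intro k
      induction k with
      | zero =>
        intro _ M hM
        obtain ⟨Y', V, i, p, w, hV, hY', hS⟩ := h.1.2 M hM
        exact ⟨Y', V, i, p, w, hV, iter_mono hs (Nat.zero_le n) hY', hS⟩
      | succ k ih =>
        intro hk M hM
        obtain ⟨M', G, f, g, w, hM', hG, hS, -⟩ := gor_left hM
        obtain ⟨U, V, i, p, w', hV, hU, hS'⟩ := ih (by omega) G hG
        obtain ⟨a, b, w'', hab⟩ := comp_epi_ext hS hS'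
        have := hS.epi_g
        have := hS'.epi_g
        dsimp at *
        refine ⟨kernel (p ≫ g), V, kernel.ι _, p ≫ g, kernel.condition _, hV,
          he a b w'' hab hU (iter_mono hs hk hM'),
          ShortComplex.ShortExact.mk' (ShortComplex.exact_kernel _)
            (by dsimp; infer_instance) (epi_comp p g)⟩
    exact key n le_rfl
  · intro V hV M hM
    have : ∀ k, ∀ M ∈ GorIter 𝒴 k, extPerp V M := by
      intro k
      induction k with
      | zero => exact fun M hM => h.2 V hV M hM
      | succ k ih => exact perp_right (hsub k hV) ih
    exact this n M hM

end

end GorAux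

variable [EnoughProjectives C] [EnoughInjectives C] [HasExt.{w} C]

/-- Proposition 3.6: fix `n ≥ 1`. (a) If `𝒲` is an injective cogenerator
for `𝒳` and `G^n(𝒳)` is closed under extensions, then `𝒲` is an injective cogenerator for
`G^n(𝒳)`. (b) Dually for projective generators. -/
theorem stmt_11 (𝒲 𝒳 𝒱 𝒴 : Set C)
    (h𝒲iso : IsoClosed 𝒲) (h𝒲sum : SumClosed 𝒲)
    (h𝒳iso : IsoClosed 𝒳) (h𝒳sum : SumClosed 𝒳)
    (h𝒱iso : IsoClosed 𝒱) (h𝒱sum : SumClosed 𝒱)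
    (h𝒴iso : IsoClosed 𝒴) (h𝒴sum : SumClosed 𝒴)
    (n : ℕ) (hn : 1 ≤ n) :
    (IsInjCogen 𝒲 𝒳 → ExtensionClosed (GorIter 𝒳 n) →
      IsInjCogen 𝒲 (GorIter 𝒳 n)) ∧
    (IsProjGen 𝒱 𝒴 → ExtensionClosed (GorIter 𝒴 n) →
      IsProjGen 𝒱 (GorIter 𝒴 n)) := by
  exact ⟨GorAux.partA h𝒳sum n, GorAux.partB h𝒴sum n⟩
end

section
/- If W is a subcategory of A with W ⊥ W, then W is both an injective cogenerator and a projective generator for the Gorenstein subcategory G(W). -/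
open CategoryTheory CategoryTheory.Limits CategoryTheory.Abelian

universe w v u

variable {C : Type u} [Category.{v} C] [Abelian C]

section Helpers

lemma gor_w_contract (W : C) :
    ((biprod.fst ≫ biprod.inr : W ⊞ W ⟶ W ⊞ W) ≫ (biprod.snd ≫ biprod.inl)) +
      ((biprod.snd ≫ biprod.inl : W ⊞ W ⟶ W ⊞ W) ≫ (biprod.fst ≫ biprod.inr)) = 𝟙 (W ⊞ W) := by
  simp

lemma gor_self (𝒲 : Set C) (hs : SumClosed 𝒲) : 𝒲 ⊆ GorClass 𝒲 := by
  intro W hW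
  have hc := gor_w_contract W
  have hdd : (biprod.fst ≫ biprod.inr : W ⊞ W ⟶ W ⊞ W) ≫
      (biprod.fst ≫ biprod.inr : W ⊞ W ⟶ W ⊞ W) = 0 := by
    simp
  have hl : ∀ {A : C} (φ : A ⟶ W ⊞ W), φ ≫ (biprod.fst ≫ biprod.inr : W ⊞ W ⟶ W ⊞ W) = 0 →
      ∃ ψ : A ⟶ W ⊞ W, ψ ≫ (biprod.fst ≫ biprod.inr : W ⊞ W ⟶ W ⊞ W) = φ := by
    intro A φ h
    refine ⟨φ ≫ biprod.snd ≫ biprod.inl, ?_⟩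
    have := congrArg (φ ≫ ·) hc
    simp only [Preadditive.comp_add] at this
    rw [← Category.assoc φ, h, zero_comp, zero_add, Category.comp_id] at this
    simpa using this
  refine ⟨fun _ => W ⊞ W, fun _ => biprod.fst ≫ biprod.inr,
    ⟨fun _ => hs hW hW, fun _ => hdd, ?_, ?_, ?_⟩, ⟨?_⟩⟩
  · intro n
    rw [ShortComplex.exact_iff_exact_up_to_refinements]
    intro A x hx
    obtain ⟨ψ, hψ⟩ := hl x hx
    exact ⟨A, 𝟙 A, inferInstance, ψ, by simpa using hψ.symm⟩
  · intro V _ n φ h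
    exact hl φ h
  · intro V _ n φ h
    refine ⟨(biprod.snd ≫ biprod.inl) ≫ φ, ?_⟩
    have := congrArg (· ≫ φ) hc
    simp only [Preadditive.add_comp] at this
    rw [Category.assoc (biprod.snd ≫ biprod.inl), h, comp_zero, add_zero, Category.id_comp] at this
    simpa using this
  · refine ⟨cokernel.desc _ biprod.fst (by simp), biprod.inl ≫ cokernel.π _, ?_, by simp⟩
    ext
    · simp
    · have h := cokernel.condition (biprod.fst ≫ biprod.inr : W ⊞ W ⟶ W ⊞ W)
      rw [Category.assoc] at h
      have h2 : (biprod.inr : W ⟶ W ⊞ W) ≫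
          cokernel.π (biprod.fst ≫ biprod.inr : W ⊞ W ⟶ W ⊞ W) = 0 :=
        (cancel_epi (biprod.fst : W ⊞ W ⟶ W)).1 (h.trans comp_zero.symm)
      simpa using h2.symm

lemma gor_shift {𝒲 : Set C} {X : ℤ → C} {d : ∀ n : ℤ, X (n + 1) ⟶ X n}
    (h : IsTotallyAcyclic 𝒲 X d) (n : ℤ) : cokernel (d n) ∈ GorClass 𝒲 := by
  have hf : ∀ k : ℤ, k + 1 + n = k + n + 1 := fun k => by ring
  have key : ∀ (a b c : ℤ) (hb : b = a + 1) (hc : c = b + 1),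
      ∃ w : (eqToHom (by rw [hc]) ≫ d b : X c ⟶ X b) ≫ (eqToHom (by rw [hb]) ≫ d a : X b ⟶ X a) = 0,
      (ShortComplex.mk _ _ w).Exact ∧
      (∀ W ∈ 𝒲, ∀ (φ : W ⟶ X b), φ ≫ (eqToHom (by rw [hb]) ≫ d a : X b ⟶ X a) = 0 →
        ∃ ψ : W ⟶ X c, ψ ≫ (eqToHom (by rw [hc]) ≫ d b : X c ⟶ X b) = φ) ∧
      (∀ W ∈ 𝒲, ∀ (φ : X b ⟶ W), (eqToHom (by rw [hc]) ≫ d b : X c ⟶ X b) ≫ φ = 0 →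
        ∃ ψ : X a ⟶ W, (eqToHom (by rw [hb]) ≫ d a : X b ⟶ X a) ≫ ψ = φ) := by
    rintro a _ _ rfl rfl
    simp only [eqToHom_refl, Category.id_comp]
    exact ⟨h.w a, h.exact a, fun W hW φ => h.homExact W hW a φ, fun W hW φ => h.homExact' W hW a φ⟩
  refine ⟨fun k => X (k + n), fun k => eqToHom (congrArg X (hf k)) ≫ d (k + n),
    ⟨fun k => h.mem _, fun k => (key _ _ _ (hf k) (hf (k+1))).1,
      fun k => (key _ _ _ (hf k) (hf (k+1))).2.1,
      fun W hW k => (key _ _ _ (hf k) (hf (k+1))).2.2.1 W hW,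
      fun W hW k => (key _ _ _ (hf k) (hf (k+1))).2.2.2 W hW⟩, ?_⟩
  have : ∀ (a b : ℤ) (ha : a = n) (hb : b = a + 1),
      Nonempty (cokernel (eqToHom (by rw [hb]) ≫ d a : X b ⟶ X a) ≅ cokernel (d n)) := by
    rintro a _ rfl rfl
    exact ⟨cokernelIsoOfEq (by simp)⟩
  exact this _ _ (by ring) (by ring)

lemma gor_ses {𝒲 : Set C} {X : ℤ → C} {d : ∀ n : ℤ, X (n + 1) ⟶ X n}
    (h : IsTotallyAcyclic 𝒲 X d) (n : ℤ) :
    ∃ w : cokernel.desc (d (n + 1)) (d n) (h.w n) ≫ cokernel.π (d n) = 0,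
      (ShortComplex.mk _ _ w).ShortExact := by
  have w : cokernel.desc (d (n + 1)) (d n) (h.w n) ≫ cokernel.π (d n) = 0 := by
    ext; simp
  refine ⟨w, ?_⟩
  have hm : Mono (cokernel.desc (d (n + 1)) (d n) (h.w n)) := (h.exact n).mono_cokernelDesc
  have hE : (ShortComplex.mk _ _ w).Exact := by
    let φ : ShortComplex.mk (d n) (cokernel.π (d n)) (by simp) ⟶ ShortComplex.mk _ _ w :=
      { τ₁ := cokernel.π _, τ₂ := 𝟙 _, τ₃ := 𝟙 _ }
    have : Epi φ.τ₁ := by dsimp [φ]; infer_instance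
    have : IsIso φ.τ₂ := by dsimp [φ]; infer_instance
    have : Mono φ.τ₃ := by dsimp [φ]; infer_instance
    exact (ShortComplex.exact_iff_of_epi_of_isIso_of_mono φ).1 (ShortComplex.exact_cokernel _)
  exact { exact := hE, mono_f := hm, epi_g := by dsimp; infer_instance }

lemma gor_iso {𝒲 : Set C} {M N : C} (e : M ≅ N) (h : M ∈ GorClass 𝒲) : N ∈ GorClass 𝒲 := by
  obtain ⟨X, d, h, ⟨f⟩⟩ := h
  exact ⟨X, d, h, ⟨f ≪≫ e⟩⟩

lemma extPerp_iso_left [HasExt.{w} C] {M N Y : C} (e : M ≅ N) (h : extPerp.{w} M Y) :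
    extPerp.{w} N Y := by
  intro i hi
  have := h i hi
  refine subsingleton_of_forall_eq 0 fun x => ?_
  have h1 : (Ext.mk₀ e.inv).comp ((Ext.mk₀ e.hom).comp x (zero_add i)) (zero_add i) = x := by simp
  rw [← h1, Subsingleton.elim ((Ext.mk₀ e.hom).comp x (zero_add i)) 0, Ext.comp_zero]

lemma extPerp_iso_right [HasExt.{w} C] {M N Y : C} (e : M ≅ N) (h : extPerp.{w} Y M) :
    extPerp.{w} Y N := by
  intro i hi
  have := h i hi
  refine subsingleton_of_forall_eq 0 fun x => ?_
  have h1 : (x.comp (Ext.mk₀ e.inv) (add_zero i)).comp (Ext.mk₀ e.hom) (add_zero i) = x := by simp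
  rw [← h1, Subsingleton.elim (x.comp (Ext.mk₀ e.inv) (add_zero i)) 0, Ext.zero_comp]

lemma gor_perp_left [HasExt.{w} C] {𝒲 : Set C} {X : ℤ → C} {d : ∀ n : ℤ, X (n + 1) ⟶ X n}
    (hperp : ∀ W ∈ 𝒲, ∀ W' ∈ 𝒲, extPerp.{w} W W')
    (h : IsTotallyAcyclic 𝒲 X d) (W : C) (hW : W ∈ 𝒲) (i : ℕ) : ∀ (n : ℤ),
    Subsingleton (Ext.{w} (cokernel (d n)) W (i + 1)) := by
  induction i with
  | zero =>
    intro n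
    obtain ⟨w, hS⟩ := gor_ses h n
    have := hperp _ (h.mem n) W hW 1 le_rfl
    refine subsingleton_of_forall_eq 0 fun x => ?_
    obtain ⟨y, hy⟩ := Ext.contravariant_sequence_exact₃ hS W x
      (@Subsingleton.elim _ this _ _) (n₀ := 0) rfl
    obtain ⟨y, rfl⟩ := (Ext.mk₀_bijective _ _).2 y
    obtain ⟨ψ, hψ⟩ := h.homExact' W hW n (cokernel.π (d (n + 1)) ≫ y) (by simp)
    have hy' : y = cokernel.desc (d (n + 1)) (d n) (h.w n) ≫ ψ := by
      ext; simp [hψ]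
    rw [← hy, hy', ← Ext.mk₀_comp_mk₀]
    exact hS.extClass_comp_assoc _
  | succ i ih =>
    intro n
    obtain ⟨w, hS⟩ := gor_ses h n
    have := hperp _ (h.mem n) W hW (i + 1 + 1) (by lia)
    have := ih (n + 1)
    refine subsingleton_of_forall_eq 0 fun x => ?_
    obtain ⟨y, hy⟩ := Ext.contravariant_sequence_exact₃ hS W x
      (Subsingleton.elim (α := Ext.{w} (X n) W (i + 1 + 1)) _ _) (n₀ := i + 1) (by lia)
    rw [← hy, Subsingleton.elim (α := Ext.{w} (cokernel (d (n+1))) W (i + 1)) y 0, Ext.comp_zero]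

lemma gor_perp_right [HasExt.{w} C] {𝒲 : Set C} {X : ℤ → C} {d : ∀ n : ℤ, X (n + 1) ⟶ X n}
    (hperp : ∀ W ∈ 𝒲, ∀ W' ∈ 𝒲, extPerp.{w} W W')
    (h : IsTotallyAcyclic 𝒲 X d) (W : C) (hW : W ∈ 𝒲) (i : ℕ) : ∀ (n : ℤ),
    Subsingleton (Ext.{w} W (cokernel (d n)) (i + 1)) := by
  induction i with
  | zero =>
    intro n
    obtain ⟨k, rfl⟩ : ∃ k : ℤ, n = k + 1 + 1 := ⟨n - 1 - 1, by ring⟩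
    obtain ⟨w, hS⟩ := gor_ses h (k + 1)
    obtain ⟨w', hS'⟩ := gor_ses h k
    have hm : Mono (cokernel.desc (d (k + 1)) (d k) (h.w k)) := hS'.mono_f
    have := hperp W hW _ (h.mem (k + 1)) 1 le_rfl
    refine subsingleton_of_forall_eq 0 fun x => ?_
    obtain ⟨y, hy⟩ := Ext.covariant_sequence_exact₁ W hS x
      (@Subsingleton.elim _ this _ _) (n₀ := 0) rfl
    obtain ⟨y, rfl⟩ := (Ext.mk₀_bijective _ _).2 y
    obtain ⟨m, rfl⟩ : ∃ m : ℤ, k = m + 1 := ⟨k - 1, by ring⟩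
    obtain ⟨ψ, hψ⟩ := h.homExact W hW m
      (y ≫ cokernel.desc (d (m + 1 + 1)) (d (m + 1)) (h.w (m + 1))) (by
        have : cokernel.desc (d (m + 1 + 1)) (d (m + 1)) (h.w (m + 1)) ≫ d m = 0 := by
          ext; simp [h.w]
        rw [Category.assoc, this, comp_zero])
    have hy' : y = ψ ≫ cokernel.π (d (m + 1 + 1)) := by
      rw [← cancel_mono (cokernel.desc (d (m + 1 + 1)) (d (m + 1)) (h.w (m + 1)))]
      simp [hψ]
    rw [← hy, hy', ← Ext.mk₀_comp_mk₀, Ext.comp_assoc_of_second_deg_zero]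
    have := hS.comp_extClass
    dsimp at this
    rw [this, Ext.comp_zero]
  | succ i ih =>
    intro n
    obtain ⟨k, rfl⟩ : ∃ k : ℤ, n = k + 1 := ⟨n - 1, by ring⟩
    obtain ⟨w, hS⟩ := gor_ses h k
    have := hperp W hW _ (h.mem k) (i + 1 + 1) (by lia)
    have := ih k
    refine subsingleton_of_forall_eq 0 fun x => ?_
    obtain ⟨y, hy⟩ := Ext.covariant_sequence_exact₁ W hS x
      (Subsingleton.elim (α := Ext.{w} W (X k) (i + 1 + 1)) _ _) (n₀ := i + 1) (by lia)
    rw [← hy, Subsingleton.elim (α := Ext.{w} W (cokernel (d k)) (i + 1)) y 0, Ext.zero_comp]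

lemma gor_cogen {𝒲 : Set C} (hs : SumClosed 𝒲) : IsCogen 𝒲 (GorClass 𝒲) := by
  refine ⟨gor_self 𝒲 hs, ?_⟩
  rintro M ⟨X, d, h, ⟨e⟩⟩
  obtain ⟨n, ⟨e⟩⟩ : ∃ n : ℤ, Nonempty (cokernel (d n) ≅ M) := ⟨0, ⟨e⟩⟩
  obtain ⟨k, rfl⟩ : ∃ k : ℤ, n = k + 1 := ⟨n - 1, by ring⟩
  obtain ⟨w, hS⟩ := gor_ses h k
  refine ⟨X k, cokernel (d k), e.inv ≫ cokernel.desc (d (k + 1)) (d k) (h.w k), cokernel.π _,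
    by rw [Category.assoc, w, comp_zero], h.mem k, gor_shift h k, ?_⟩
  refine ShortComplex.shortExact_of_iso (S₁ := ShortComplex.mk _ _ w)
    (ShortComplex.isoMk e (Iso.refl _) (Iso.refl _) (by simp) (by simp)) hS

lemma gor_gen {𝒲 : Set C} (hs : SumClosed 𝒲) : IsGen 𝒲 (GorClass 𝒲) := by
  refine ⟨gor_self 𝒲 hs, ?_⟩
  rintro M ⟨X, d, h, ⟨e⟩⟩
  obtain ⟨w, hS⟩ := gor_ses h 0
  refine ⟨cokernel (d (0 + 1)), X 0, cokernel.desc (d (0 + 1)) (d 0) (h.w 0),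
    cokernel.π _ ≫ e.hom, by rw [← Category.assoc, w, zero_comp], h.mem 0,
    gor_shift h _, ?_⟩
  refine ShortComplex.shortExact_of_iso (S₁ := ShortComplex.mk _ _ w)
    (ShortComplex.isoMk (Iso.refl _) (Iso.refl _) e (by simp) (by simp)) hS

end Helpers

variable [EnoughProjectives C] [EnoughInjectives C] [HasExt.{w} C]

/-- Corollary 3.7: if `𝒲 ⊥ 𝒲`, then `𝒲` is both an injective cogenerator
and a projective generator for `G(𝒲)`. -/
theorem stmt_12 (𝒲 : Set C) (h𝒲iso : IsoClosed 𝒲) (h𝒲sum : SumClosed 𝒲)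
    (hperp : ∀ W ∈ 𝒲, ∀ W' ∈ 𝒲, extPerp W W') :
    IsInjCogen 𝒲 (GorClass 𝒲) ∧ IsProjGen 𝒲 (GorClass 𝒲) := by
  refine ⟨⟨gor_cogen h𝒲sum, ?_⟩, ⟨gor_gen h𝒲sum, ?_⟩⟩
  · rintro M ⟨X, d, h, ⟨e⟩⟩ W hW
    refine extPerp_iso_left e fun i hi => ?_
    obtain ⟨j, rfl⟩ := Nat.exists_eq_add_of_le' hi
    exact gor_perp_left hperp h W hW j 0
  · rintro W hW M ⟨X, d, h, ⟨e⟩⟩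
    refine extPerp_iso_right e fun i hi => ?_
    obtain ⟨j, rfl⟩ := Nat.exists_eq_add_of_le' hi
    exact gor_perp_right hperp h W hW j 0
end
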